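/- arXiv:0705.1751 — 3 statements merged into one kernel-verified Lean document; each statement's English description precedes it below -/
import Mathlib

section
/- Let q = 2^m with m odd, G(x) = a_7 x^7 + ∑_{i=1}^s b_i x^(2^i+1) with a_7 ≠ 0 over F_q, and f = Tr ∘ G. For α ∈ F_q^*, define X_α = (∑_{x ∈ F_q} (-1)^(Tr(G(x+α)+G(x))))^2. Then X_α ∈ {0, 2q, 8q}. Moreover X_α = 2q if and only if Tr(ℓ) = 1, where ℓ = a_7^(-1/3) α^(-7/3) (cube roots exist uniquely since m is odd). -/
open Finset

section SignSum

/-- The nontrivial additive character of `ZMod 2`, with integer values. -/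
def signChar : AddChar (ZMod 2) ℤ where
  toFun a := (-1) ^ a.val
  map_zero_eq_one' := by decide
  map_add_eq_mul' := by decide

lemma signChar_apply (a : ZMod 2) : signChar a = (-1) ^ a.val := rfl

lemma signChar_eq_one {a : ZMod 2} (h : signChar a = 1) : a = 0 := by
  revert a; decide

lemma sum_signChar_addMonoidHom {V : Type*} [AddCommGroup V] [Fintype V] (g : V →+ ZMod 2)
    [Decidable (∀ x, g x = 0)] :
    ∑ x, signChar (g x) = if ∀ x, g x = 0 then (Fintype.card V : ℤ) else 0 := by
  classical
  have h := AddChar.sum_eq_ite (signChar.compAddMonoidHom g)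
  have e : signChar.compAddMonoidHom g = 0 ↔ ∀ x, g x = 0 := by
    constructor
    · intro h x
      exact signChar_eq_one (by simpa using DFunLike.congr_fun h x)
    · intro h
      ext x
      simp [h x]
  simp only [e] at h
  simpa using h

/-- The square of the sign sum of a quadratic function `f` with polarization `B` is either zero
or `#V` times the size of the radical `W`, the latter if `f` is constant on the radical. -/
lemma sq_sum_signChar {V : Type*} [AddCommGroup V] [Fintype V] (f : V → ZMod 2)
    (B : V →+ V →+ ZMod 2) (hf : ∀ x y, f (x + y) = f x + f y + f 0 + B x y)
    (W : Finset V) (hW : ∀ w, w ∈ W ↔ ∀ x, B w x = 0) :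
    ((∑ x, signChar (f x)) ^ 2 = 0 ∨ (∑ x, signChar (f x)) ^ 2 = #W * Fintype.card V) ∧
    ((∀ w ∈ W, f w = f 0) → (∑ x, signChar (f x)) ^ 2 = #W * Fintype.card V) := by
  classical
  have two : ∀ a : ZMod 2, a + a = 0 := by decide
  have key : (∑ x, signChar (f x)) ^ 2 =
      (∑ w ∈ W, signChar (f w + f 0)) * Fintype.card V := by
    have h1 : ∀ x : V, ∑ y, signChar (f x) * signChar (f y) =
        ∑ w, signChar (f w + f 0) * signChar (B w x) := by
      intro x
      rw [← Equiv.sum_comp (Equiv.addRight x)]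
      refine sum_congr rfl fun w _ => ?_
      rw [← AddChar.map_add_eq_mul, ← AddChar.map_add_eq_mul, Equiv.coe_addRight, hf w x]
      congr 1
      linear_combination two (f x)
    rw [sq, sum_mul_sum, sum_congr rfl fun x _ => h1 x, sum_comm, sum_mul,
      ← sum_subset (subset_univ W)]
    · refine sum_congr rfl fun w hw => ?_
      rw [← mul_sum, sum_signChar_addMonoidHom, if_pos ((hW w).1 hw)]
    · intro w _ hw
      rw [← mul_sum, sum_signChar_addMonoidHom, if_neg (fun h => hw ((hW w).2 h)), mul_zero]
  have triv (h : ∀ w ∈ W, f w = f 0) :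
      (∑ x, signChar (f x)) ^ 2 = #W * Fintype.card V := by
    rw [key, sum_congr rfl fun w hw => by rw [h w hw, two, AddChar.map_zero_eq_one]]
    simp
  refine ⟨?_, triv⟩
  let g : B.ker →+ ZMod 2 := AddMonoidHom.mk' (fun w => f w + f 0) fun a b => by
    have : B a (b : V) = 0 := by rw [AddMonoidHom.mem_ker.1 a.2]; rfl
    rw [AddSubgroup.coe_add, hf, this]
    ring
  by_cases hg : ∀ w, g w = 0
  · right
    refine triv fun w hw => ?_
    have hwB : w ∈ B.ker := by
      rw [AddMonoidHom.mem_ker]; ext x; exact (hW w).1 hw x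
    have : f w + f 0 = 0 := hg ⟨w, hwB⟩
    linear_combination this - two (f 0)
  · left
    have e : ∑ w ∈ W, signChar (f w + f 0) = ∑ w : B.ker, signChar (g w) := by
      refine sum_subtype W (fun w => ?_) (fun w => signChar (f w + f 0))
      rw [hW, AddMonoidHom.mem_ker, DFunLike.ext_iff]; rfl
    rw [key, e, sum_signChar_addMonoidHom, if_neg hg, zero_mul]

end SignSum

section BinaryTrace

variable {F : Type*} [Field F] [Fintype F] [Algebra (ZMod 2) F] [CharP F 2]

local notation "Tr" => Algebra.trace (ZMod 2) F

omit [CharP F 2] in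
lemma trace_sq_eq (x : F) : Tr (x ^ 2) = Tr x := by
  have := Algebra.trace_eq_of_algEquiv (FiniteField.frobeniusAlgEquivOfAlgebraic (ZMod 2) F) x
  simpa using this

omit [CharP F 2] in
lemma trace_one_of_odd (h : Odd (Module.finrank (ZMod 2) F)) : Tr (1 : F) = 1 := by
  have := Algebra.trace_algebraMap (S := F) (1 : ZMod 2)
  rw [map_one] at this
  rw [this, nsmul_one]
  exact ZMod.natCast_eq_one_iff_odd.2 h

omit [CharP F 2] in
lemma eq_zero_of_trace_mul_eq_zero {A : F} (h : ∀ w, Tr (A * w) = 0) : A = 0 :=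
  (traceForm_nondegenerate (ZMod 2) F).1 A h

omit [CharP F 2] in
lemma eq_zero_or_eq_of_trace_mul {A L : F} (h : ∀ w, Tr (L * w) = 0 → Tr (A * w) = 0) :
    A = 0 ∨ A = L := by
  have two : ∀ a : ZMod 2, a = 0 ∨ a = 1 := by decide
  by_cases hL : ∀ w, Tr (L * w) = 0
  · exact .inl (eq_zero_of_trace_mul_eq_zero fun w => h w (hL w))
  push Not at hL
  obtain ⟨w₀, hw₀⟩ := hL
  have hw₀ := (two _).resolve_left hw₀
  have key (w : F) (hw : Tr (L * w) = 1) : Tr (A * w) = Tr (A * w₀) := by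
    have := h (w - w₀) (by rw [mul_sub, map_sub, hw, hw₀, sub_self])
    rwa [mul_sub, map_sub, sub_eq_zero] at this
  rcases two (Tr (A * w₀)) with h0 | h1
  · left
    refine eq_zero_of_trace_mul_eq_zero fun w => ?_
    rcases two (Tr (L * w)) with hw | hw
    · exact h w hw
    · rw [key w hw, h0]
  · right
    rw [← sub_eq_zero]
    refine eq_zero_of_trace_mul_eq_zero fun w => ?_
    rw [sub_mul, map_sub]
    rcases two (Tr (L * w)) with hw | hw
    · rw [h w hw, hw, sub_zero]
    · rw [key w hw, h1, hw, sub_self]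

omit [CharP F 2] in
lemma trace_sq_add_self (z : F) : Tr (z ^ 2 + z) = 0 := by
  rw [map_add, trace_sq_eq]; exact CharTwo.add_self_eq_zero _

omit [Fintype F] [Algebra (ZMod 2) F] in
lemma sq_add_self_eq_iff {z p : F} : z ^ 2 + z = p ^ 2 + p ↔ z = p ∨ z = p + 1 := by
  have h2 : (2 : F) = 0 := CharTwo.two_eq_zero
  have : z ^ 2 + z - (p ^ 2 + p) = (z - p) * (z - (p + 1)) := by
    linear_combination (z + z * p - p - p ^ 2) * h2
  rw [← sub_eq_zero, this, mul_eq_zero, sub_eq_zero, sub_eq_zero]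

/-- Additive Hilbert 90 over the field with two elements. -/
lemma exists_sq_add_self_eq {u : F} (hu : Tr u = 0) : ∃ z, z ^ 2 + z = u := by
  let φ : F →+ F := AddMonoidHom.mk' (fun z => z ^ 2 + z) fun a b => by
    rw [CharTwo.add_sq]; ring
  let P : F →ₗ[ZMod 2] F := φ.toZModLinearMap 2
  have hP (z : F) : P z = z ^ 2 + z := rfl
  let S := LinearMap.range P
  by_contra hne
  have hS : u ∉ S := fun ⟨z, hz⟩ => hne ⟨z, hz⟩
  obtain ⟨g, hgu, hgS⟩ := Submodule.exists_le_ker_of_notMem hS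
  obtain ⟨A, hA⟩ : ∃ A : F, ∀ x, g x = Tr (A * x) := by
    let e := (Algebra.traceForm (ZMod 2) F).toDual (traceForm_nondegenerate (ZMod 2) F)
    refine ⟨e.symm g, fun x => ?_⟩
    have := DFunLike.congr_fun (e.apply_symm_apply g) x
    rw [← this]; rfl
  have hA2 : A ^ 2 + A = 0 ^ 2 + 0 := by
    have : A + A ^ 2 = 0 := by
      refine eq_zero_of_trace_mul_eq_zero fun w => ?_
      obtain ⟨v, rfl⟩ : ∃ v, v ^ 2 = w :=
        ⟨_, (FiniteField.frobeniusAlgEquivOfAlgebraic (ZMod 2) F).apply_symm_apply w⟩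
      have h := hgS ⟨v, rfl⟩
      rw [LinearMap.mem_ker, hA, hP] at h
      rw [← h, add_mul, mul_add, map_add, map_add, ← mul_pow, trace_sq_eq]
    linear_combination this
  rcases sq_add_self_eq_iff.1 hA2 with rfl | rfl
  · exact hgu (by rw [hA, zero_mul, map_zero])
  · exact hgu (by rw [hA, zero_add, one_mul, hu])

lemma pow_four_add_self_eq_zero_iff (h1 : Tr (1 : F) = 1) {t : F} :
    t ^ 4 + t = 0 ↔ t = 0 ∨ t = 1 := by
  have h2 : (2 : F) = 0 := CharTwo.two_eq_zero
  constructor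
  · intro h
    have hv : (t ^ 2 + t) ^ 2 + (t ^ 2 + t) = 0 ^ 2 + 0 := by
      linear_combination h + (t ^ 3 + t ^ 2) * h2
    rcases sq_add_self_eq_iff.1 hv with hv | hv
    · simpa using sq_add_self_eq_iff.1 (hv.trans (by simp : (0 : F) = 0 ^ 2 + 0))
    · have := trace_sq_add_self t
      rw [hv, zero_add, h1] at this
      exact absurd this (by decide)
  · rintro (rfl | rfl)
    · simp
    · linear_combination h2

omit [CharP F 2] in
lemma trace_pow_four_add_self (t : F) : Tr (t ^ 4 + t) = 0 := by
  rw [map_add, show t ^ 4 = (t ^ 2) ^ 2 by ring, trace_sq_eq, trace_sq_eq]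
  exact CharTwo.add_self_eq_zero _

lemma exists_pow_four_add_self_eq (h1 : Tr (1 : F) = 1) {u : F} (hu : Tr u = 0) :
    ∃ t, t ^ 4 + t = u := by
  have h2 : (2 : F) = 0 := CharTwo.two_eq_zero
  have two : ∀ a : ZMod 2, a = 0 ∨ a = 1 := by decide
  obtain ⟨p, hp, hpT⟩ : ∃ p, p ^ 2 + p = u ∧ Tr p = 0 := by
    obtain ⟨p, hp⟩ := exists_sq_add_self_eq hu
    rcases two (Tr p) with h | h
    · exact ⟨p, hp, h⟩
    · refine ⟨p + 1, ?_, ?_⟩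
      · rw [← hp]; exact sq_add_self_eq_iff.2 (.inr rfl)
      · rw [map_add, h, h1]; decide
  obtain ⟨t, rfl⟩ := exists_sq_add_self_eq hpT
  exact ⟨t, by rw [← hp]; linear_combination (-t ^ 3 - t ^ 2) * h2⟩

/-- The bilinear form `(z, y) ↦ Tr (c * Δ(1, z, y))`, where `Δ` is the Moore determinant. -/
noncomputable def mooreForm (c : F) : F →+ F →+ ZMod 2 :=
  AddMonoidHom.mk' (fun z => AddMonoidHom.mk'
    (fun y => Tr (c * ((z ^ 2 + z) * (y ^ 2 + y) ^ 2 + (z ^ 2 + z) ^ 2 * (y ^ 2 + y))))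
    fun a b => by
      rw [← map_add]; congr 1; simp only [CharTwo.add_sq]; ring)
    fun a b => by
      ext y
      simp only [AddMonoidHom.mk'_apply, AddMonoidHom.add_apply]
      rw [← map_add]; congr 1; simp only [CharTwo.add_sq]; ring

omit [Fintype F] in
lemma mooreForm_apply (c z y : F) : mooreForm c z y =
    Tr (c * ((z ^ 2 + z) * (y ^ 2 + y) ^ 2 + (z ^ 2 + z) ^ 2 * (y ^ 2 + y))) := rfl

lemma mooreForm_eq_trace_mul_sq {c l z y u v : F} (hc : c * l ^ 3 = 1)
    (hz : z ^ 2 + z = l * u) (hy : y ^ 2 + y = l * v) :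
    mooreForm c z y = Tr ((u ^ 4 + u) * v ^ 2) := by
  have : c * (l * u * (l * v) ^ 2 + (l * u) ^ 2 * (l * v)) = u * v ^ 2 + u ^ 2 * v := by
    linear_combination (u * v ^ 2 + u ^ 2 * v) * hc
  rw [mooreForm_apply, hz, hy, this, map_add, ← trace_sq_eq (u ^ 2 * v), ← map_add]
  congr 1
  ring

lemma mooreForm_eq_zero_iff {c l z u : F} (hc : c * l ^ 3 = 1) (hz : z ^ 2 + z = l * u) :
    (∀ y, mooreForm c z y = 0) ↔ u ^ 4 + u = 0 ∨ u ^ 4 + u = l ^ 2 := by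
  have hl : l ≠ 0 := by rintro rfl; simp at hc
  constructor
  · intro h
    refine eq_zero_or_eq_of_trace_mul fun w hw => ?_
    obtain ⟨v, rfl⟩ : ∃ v, v ^ 2 = w :=
      ⟨_, (FiniteField.frobeniusAlgEquivOfAlgebraic (ZMod 2) F).apply_symm_apply w⟩
    rw [← mul_pow, trace_sq_eq] at hw
    obtain ⟨y, hy⟩ := exists_sq_add_self_eq hw
    rw [← mooreForm_eq_trace_mul_sq hc hz hy, h]
  · intro h y
    have hy : y ^ 2 + y = l * (l⁻¹ * (y ^ 2 + y)) := by field_simp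
    rw [mooreForm_eq_trace_mul_sq hc hz hy]
    rcases h with h | h
    · rw [h, zero_mul, map_zero]
    · rw [h, ← mul_pow, trace_sq_eq, ← hy, trace_sq_add_self]

lemma mooreForm_radical_of_trace_eq_one (h1 : Tr (1 : F) = 1) {c l : F} (hc : c * l ^ 3 = 1)
    (hl : Tr l = 1) (z : F) : (∀ y, mooreForm c z y = 0) ↔ z = 0 ∨ z = 1 := by
  have hl0 : l ≠ 0 := by rintro rfl; simp at hc
  have hz : z ^ 2 + z = l * (l⁻¹ * (z ^ 2 + z)) := by field_simp
  constructor
  · rw [mooreForm_eq_zero_iff hc hz]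
    generalize l⁻¹ * (z ^ 2 + z) = u at hz
    have h01 : (1 : ZMod 2) ≠ 0 := by decide
    rintro (h | h)
    · rcases (pow_four_add_self_eq_zero_iff h1).1 h with rfl | rfl
      · simpa using sq_add_self_eq_iff.1 (hz.trans (by simp : l * 0 = 0 ^ 2 + 0))
      · have := trace_sq_add_self z
        rw [hz, mul_one, hl] at this
        exact absurd this h01
    · have := trace_pow_four_add_self u
      rw [h, trace_sq_eq, hl] at this
      exact absurd this h01
  · intro h y
    have : z ^ 2 + z = 0 := by
      simpa using sq_add_self_eq_iff.2 (show z = 0 ∨ z = 0 + 1 by simpa using h)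
    simp [mooreForm_apply, this]

lemma card_mooreForm_radical_of_trace_eq_zero (h1 : Tr (1 : F) = 1) {c l : F}
    (hc : c * l ^ 3 = 1) (hl : Tr l = 0) {W : Finset F}
    (hW : ∀ z, z ∈ W ↔ ∀ y, mooreForm c z y = 0) : #W = 8 := by
  classical
  have h2 : (2 : F) = 0 := CharTwo.two_eq_zero
  have hl0 : l ≠ 0 := by rintro rfl; simp at hc
  obtain ⟨t, ht⟩ := exists_pow_four_add_self_eq h1 ((trace_sq_eq l).trans hl)
  have hlt : Tr (l * t) = 0 := by
    rw [← trace_sq_eq, mul_pow, ← ht,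
      show (t ^ 4 + t) * t ^ 2 = (t ^ 3) ^ 2 + t ^ 3 by ring, trace_sq_add_self]
  have ht01 : ¬ (t = 0 ∨ t = 1) := by
    rw [← pow_four_add_self_eq_zero_iff h1, ht]
    exact pow_ne_zero 2 hl0
  push Not at ht01
  have ht1 : t + 1 ≠ 0 := fun h => ht01.2 (by linear_combination h - h2)
  let U : Finset F := {0, 1, t, t + 1}
  have hU : #U = 4 := by
    have := ht01.1.symm
    have := ht01.2.symm
    have := ht1.symm
    rw [card_insert_of_notMem, card_insert_of_notMem, card_pair]
    all_goals simp_all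
  have hUiff (u : F) : u ^ 4 + u = 0 ∨ u ^ 4 + u = l ^ 2 ↔ u ∈ U := by
    have e : u ^ 4 + u = l ^ 2 ↔ (u + t) ^ 4 + (u + t) = 0 := by
      rw [← ht]
      constructor <;> intro h
      · linear_combination h + (2 * u ^ 3 * t + 3 * u ^ 2 * t ^ 2 + 2 * u * t ^ 3
          + t ^ 4 + t) * h2
      · linear_combination h - (2 * u ^ 3 * t + 3 * u ^ 2 * t ^ 2 + 2 * u * t ^ 3
          + t ^ 4 + t) * h2
    have e0 : u + t = 0 ↔ u = t := CharTwo.add_eq_zero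
    have e1 : u + t = 1 ↔ u = t + 1 := by
      constructor <;> intro h
      · linear_combination h - t * h2
      · linear_combination h + t * h2
    rw [e, pow_four_add_self_eq_zero_iff h1, pow_four_add_self_eq_zero_iff h1, e0, e1]
    simp only [U, mem_insert, mem_singleton, or_assoc]
  have hUT : ∀ u ∈ U, Tr (l * u) = 0 := by
    intro u hu
    simp only [U, mem_insert, mem_singleton] at hu
    rcases hu with rfl | rfl | rfl | rfl
    · rw [mul_zero, map_zero]
    · rw [mul_one, hl]
    · exact hlt
    · rw [mul_add, mul_one, map_add, hlt, hl, add_zero]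
  have hmaps : ∀ z ∈ W, l⁻¹ * (z ^ 2 + z) ∈ U := by
    intro z hz
    have hz' : z ^ 2 + z = l * (l⁻¹ * (z ^ 2 + z)) := by field_simp
    rw [← hUiff, ← mooreForm_eq_zero_iff hc hz', ← hW]
    exact hz
  rw [card_eq_sum_card_fiberwise hmaps, sum_congr rfl (g := fun _ => 2), sum_const, hU]
  · rfl
  intro u hu
  obtain ⟨p, hp⟩ := exists_sq_add_self_eq (hUT u hu)
  rw [card_eq_two]
  refine ⟨p, p + 1, by simp, ?_⟩
  ext z
  have hiff : l⁻¹ * (z ^ 2 + z) = u ↔ z = p ∨ z = p + 1 := by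
    rw [← sq_add_self_eq_iff, hp, inv_mul_eq_iff_eq_mul₀ hl0]
  simp only [mem_filter, mem_insert, mem_singleton, hiff, and_iff_right_iff_imp]
  intro hz
  rw [hW, mooreForm_eq_zero_iff (u := u) hc (by rw [← hp, sq_add_self_eq_iff]; exact hz), hUiff]
  exact hu

/-- The squared sign sum for the derivative in direction `1` of `c x⁷ + ∑ bᵢ x^(2^i+1)`. -/
lemma sq_sum_derivative_one (h1 : Tr (1 : F) = 1) {c l : F} (hc : c * l ^ 3 = 1)
    (I : Finset ℕ) (b : ℕ → F) (G : F → F)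
    (hG : ∀ x, G x = c * x ^ 7 + ∑ i ∈ I, b i * x ^ (2 ^ i + 1)) :
    (Tr l = 1 → (∑ x, signChar (Tr (G (x + 1) + G x))) ^ 2 = 2 * Fintype.card F) ∧
    (Tr l = 0 → (∑ x, signChar (Tr (G (x + 1) + G x))) ^ 2 = 0 ∨
      (∑ x, signChar (Tr (G (x + 1) + G x))) ^ 2 = 8 * Fintype.card F) := by
  classical
  have h2 : (2 : F) = 0 := CharTwo.two_eq_zero
  have hder (x : F) : G (x + 1) + G x =
      c * ((x + 1) ^ 7 + x ^ 7) + ∑ i ∈ I, b i * (x ^ 2 ^ i + x + 1) := by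
    rw [hG, hG, add_add_add_comm, ← sum_add_distrib, ← mul_add]
    congr 1
    refine sum_congr rfl fun i _ => ?_
    rw [pow_succ, pow_succ, add_pow_char_pow]
    linear_combination (b i * x ^ 2 ^ i * x) * h2 +
      (b i * (x + 1)) * one_pow (M := F) (2 ^ i)
  have hsum (x y : F) : ∑ i ∈ I, b i * ((x + y) ^ 2 ^ i + (x + y) + 1) =
      ∑ i ∈ I, b i * (x ^ 2 ^ i + x + 1) + ∑ i ∈ I, b i * (y ^ 2 ^ i + y + 1) +
        ∑ i ∈ I, b i * (0 ^ 2 ^ i + 0 + 1) := by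
    rw [← sum_add_distrib, ← sum_add_distrib]
    refine sum_congr rfl fun i _ => ?_
    rw [add_pow_char_pow, zero_pow (by positivity)]
    linear_combination (-b i) * h2
  have hf (x y : F) : Tr (G (x + y + 1) + G (x + y)) = Tr (G (x + 1) + G x) +
      Tr (G (y + 1) + G y) + Tr (G (0 + 1) + G 0) + mooreForm c x y := by
    rw [mooreForm_apply, ← map_add, ← map_add, ← map_add, hder, hder, hder, hder, hsum]
    congr 1
    have : (x + y + 1) ^ 7 + (x + y) ^ 7 = ((x + 1) ^ 7 + x ^ 7) + ((y + 1) ^ 7 + y ^ 7)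
        + ((0 + 1) ^ 7 + 0 ^ 7) + ((x ^ 2 + x) * (y ^ 2 + y) ^ 2
        + (x ^ 2 + x) ^ 2 * (y ^ 2 + y)) := by
      grind
    linear_combination c * this
  let W : Finset F := univ.filter fun w => ∀ x, mooreForm c w x = 0
  have hW (w : F) : w ∈ W ↔ ∀ x, mooreForm c w x = 0 := by simp [W]
  obtain ⟨hor, htriv⟩ := sq_sum_signChar (fun x => Tr (G (x + 1) + G x)) (mooreForm c) hf W hW
  constructor
  · intro hl
    have hW01 : W = {0, 1} := by
      ext z
      rw [hW, mooreForm_radical_of_trace_eq_one h1 hc hl]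
      simp
    rw [htriv, hW01, card_pair zero_ne_one, Nat.cast_ofNat]
    rw [hW01]
    simp [CharTwo.add_self_eq_zero, add_comm]
  · intro hl
    rwa [card_mooreForm_radical_of_trace_eq_zero h1 hc hl hW] at hor

omit [CharP F 2] in
lemma exists_cube_eq (h : Odd (Module.finrank (ZMod 2) F)) {a : F} (ha : a ≠ 0) :
    ∃ l : F, l ^ 3 = a := by
  have hcop : (Nat.card Fˣ).Coprime 3 := by
    rw [Nat.card_units, Nat.card_eq_fintype_card,
      Module.card_eq_pow_finrank (K := ZMod 2) (V := F), ZMod.card]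
    obtain ⟨k, hk⟩ := h
    rw [hk, Nat.coprime_comm, Nat.Prime.coprime_iff_not_dvd Nat.prime_three, pow_succ, pow_mul]
    have := Nat.pow_mod 4 k 3
    norm_num at this ⊢
    omega
  obtain ⟨l, hl⟩ := (powCoprime hcop).surjective (Units.mk0 a ha)
  exact ⟨l, by simpa using congrArg Units.val hl⟩

end BinaryTrace

theorem stmt12 (m s : ℕ) (hm : Odd m) (hm0 : 0 < m) [Fintype (GaloisField 2 m)]
    (a7 : GaloisField 2 m) (ha7 : a7 ≠ 0) (b : ℕ → GaloisField 2 m)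
    (G : GaloisField 2 m → GaloisField 2 m)
    (hG : ∀ x, G x = a7 * x ^ 7 + ∑ i ∈ Finset.Icc 1 s, b i * x ^ (2 ^ i + 1))
    (α : GaloisField 2 m) (hα : α ≠ 0)
    (X : ℤ)
    (hX : X = (∑ x : GaloisField 2 m,
      (-1 : ℤ) ^ (Algebra.trace (ZMod 2) (GaloisField 2 m) (G (x + α) + G x)).val) ^ 2) :
    (X = 0 ∨ X = 2 * 2 ^ m ∨ X = 8 * 2 ^ m) ∧
    ∀ ℓ : GaloisField 2 m, ℓ ^ 3 = a7⁻¹ * (α⁻¹) ^ 7 →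
      (X = 2 * 2 ^ m ↔ Algebra.trace (ZMod 2) (GaloisField 2 m) ℓ = 1) := by
  have hfin : Module.finrank (ZMod 2) (GaloisField 2 m) = m := GaloisField.finrank 2 hm0.ne'
  have hodd : Odd (Module.finrank (ZMod 2) (GaloisField 2 m)) := by rwa [hfin]
  have h1 := trace_one_of_odd hodd
  have hcard : (Fintype.card (GaloisField 2 m) : ℤ) = 2 ^ m := by
    rw [Module.card_eq_pow_finrank (K := ZMod 2), ZMod.card, hfin]; norm_cast
  have hXs : X = (∑ x, signChar (Algebra.trace (ZMod 2) (GaloisField 2 m)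
      (G (α * (x + 1)) + G (α * x)))) ^ 2 := by
    rw [hX, ← Equiv.sum_comp (Equiv.mulLeft₀ α hα)]
    simp [signChar_apply, mul_add]
  have hscale (x : GaloisField 2 m) : G (α * x) = a7 * α ^ 7 * x ^ 7 +
      ∑ i ∈ Icc 1 s, b i * α ^ (2 ^ i + 1) * x ^ (2 ^ i + 1) := by
    simp only [hG, mul_pow, mul_assoc]
  have key (l : GaloisField 2 m) (hl : l ^ 3 = a7⁻¹ * α⁻¹ ^ 7) :=
    sq_sum_derivative_one h1 (c := a7 * α ^ 7) (l := l) (by rw [hl]; field_simp)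
      (Icc 1 s) (fun i => b i * α ^ (2 ^ i + 1)) (fun x => G (α * x)) hscale
  simp only [← hXs, hcard] at key
  have two : ∀ a : ZMod 2, a = 0 ∨ a = 1 := by decide
  have hq : (0 : ℤ) < 2 ^ m := by positivity
  constructor
  · obtain ⟨l, hl⟩ := exists_cube_eq hodd
      (mul_ne_zero (inv_ne_zero ha7) (pow_ne_zero 7 (inv_ne_zero hα)))
    rcases two (Algebra.trace (ZMod 2) (GaloisField 2 m) l) with h | h
    · rcases (key l hl).2 h with h | h
      · exact .inl h
      · exact .inr (.inr h)
    · exact .inr (.inl ((key l hl).1 h))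
  · intro l hl
    refine ⟨fun hX2 => ?_, (key l hl).1⟩
    refine (two _).resolve_left fun h => ?_
    rcases (key l hl).2 h with h | h <;> omega
end

section
/- Let q = 2^m with m odd, G(x) = a_7 x^7 + ∑_{i=1}^s b_i x^(2^i+1) with a_7 ≠ 0 over F_q, and f = Tr ∘ G. Then | ‖f̂‖_4^4 − 3q^2 | ≤ 185·2^(s−1)·q^(3/2), where ‖f̂‖_4^4 = (1/q)∑_v f̂(v)^4. -/
open Finset

/-- Walsh transform of `f` on `F_{2^m}` with pairing `Tr(vx)`. -/
noncomputable def walshF (m : ℕ) [Fintype (GaloisField 2 m)]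
    (f : GaloisField 2 m → ZMod 2) (v : GaloisField 2 m) : ℤ :=
  ∑ x : GaloisField 2 m,
    (-1 : ℤ) ^ (f x + Algebra.trace (ZMod 2) (GaloisField 2 m) (v * x)).val

section Stepanov

open Polynomial

namespace QuadraticAlgebra

theorem degree_norm_eq_max {K : Type*} [Field K] {Φ : K[X]} {e g : ℕ}
    (hΦ : Φ.natDegree = 2 * g + 1) (he : e ≤ g) (z : QuadraticAlgebra K[X] Φ (X ^ e)) :
    (norm z).degree = max (z.re * z.re).degree (Φ * z.im * z.im).degree := by
  have hΦ0 : Φ ≠ 0 := by rintro rfl; simp at hΦ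
  rw [norm_def]
  by_cases hp : z.re = 0
  · simp [hp]
  by_cases hs : z.im = 0
  · simp [hs]
  have hA : (z.re * z.re).degree = ((2 * z.re.natDegree : ℕ) : WithBot ℕ) := by
    rw [degree_eq_natDegree (by simp [hp]), natDegree_mul hp hp, two_mul]
  have hB : (Φ * z.im * z.im).degree = ((2 * g + 1 + 2 * z.im.natDegree : ℕ) : WithBot ℕ) := by
    rw [degree_eq_natDegree (by simp [hΦ0, hs]), natDegree_mul (by simp [hΦ0, hs]) hs,
      natDegree_mul hΦ0 hs, hΦ]
    congr 1
    ring
  have hC : (X ^ e * z.re * z.im).degree =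
      ((e + z.re.natDegree + z.im.natDegree : ℕ) : WithBot ℕ) := by
    rw [degree_eq_natDegree (by simp [hp, hs]), natDegree_mul (by simp [hp]) hs,
      natDegree_mul (by simp) hp, natDegree_X_pow]
  rcases lt_or_ge (2 * z.re.natDegree) (2 * g + 1 + 2 * z.im.natDegree) with h | h
  · have h1 : (z.re * z.re).degree < (Φ * z.im * z.im).degree := by
      rw [hA, hB]; exact_mod_cast h
    have h2 : (X ^ e * z.re * z.im).degree < (Φ * z.im * z.im).degree := by
      rw [hC, hB]; exact_mod_cast (by omega)
    rw [degree_sub_eq_right_of_degree_lt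
      (lt_of_le_of_lt (degree_add_le _ _) (max_lt h1 h2)), max_eq_right h1.le]
  · have h1 : (Φ * z.im * z.im).degree < (z.re * z.re).degree := by
      rw [hA, hB]; exact_mod_cast (by omega)
    have h2 : (X ^ e * z.re * z.im).degree < (z.re * z.re).degree := by
      rw [hC, hA]; exact_mod_cast (by omega)
    have h3 : (z.re * z.re + X ^ e * z.re * z.im).degree = (z.re * z.re).degree :=
      degree_add_eq_left_of_degree_lt h2
    rw [degree_sub_eq_left_of_degree_lt (by rw [h3]; exact h1), h3, max_eq_left h1.le]

theorem degree_norm_lt_iff {K : Type*} [Field K] {Φ : K[X]} {e g : ℕ}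
    (hΦ : Φ.natDegree = 2 * g + 1) (he : e ≤ g) (z : QuadraticAlgebra K[X] Φ (X ^ e)) (n : ℕ) :
    (norm z).degree < n ↔ (∀ j, n ≤ 2 * j → z.re.coeff j = 0) ∧
      ∀ j, n ≤ 2 * j + (2 * g + 1) → z.im.coeff j = 0 := by
  have hΦ0 : Φ ≠ 0 := by rintro rfl; simp at hΦ
  rw [degree_norm_eq_max hΦ he, max_lt_iff]
  refine and_congr ?_ ?_
  · by_cases hp : z.re = 0
    · simp [hp]
    rw [degree_eq_natDegree (by simp [hp]), natDegree_mul hp hp, Nat.cast_lt]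
    refine ⟨fun h j hj => coeff_eq_zero_of_natDegree_lt (by omega), fun h => ?_⟩
    by_contra! h'
    exact hp (leadingCoeff_eq_zero.mp (h _ (by omega)))
  · by_cases hs : z.im = 0
    · simp [hs]
    rw [degree_eq_natDegree (by simp [hΦ0, hs]), natDegree_mul (by simp [hΦ0, hs]) hs,
      natDegree_mul hΦ0 hs, hΦ, Nat.cast_lt]
    refine ⟨fun h j hj => coeff_eq_zero_of_natDegree_lt (by omega), fun h => ?_⟩
    by_contra! h'
    exact hs (leadingCoeff_eq_zero.mp (h _ (by omega)))

theorem degree_norm_sum_lt {K ι : Type*} [Field K] {Φ : K[X]} {e g : ℕ}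
    (hΦ : Φ.natDegree = 2 * g + 1) (he : e ≤ g) (s : Finset ι)
    (z : ι → QuadraticAlgebra K[X] Φ (X ^ e)) (n : ℕ) (h : ∀ i ∈ s, (norm (z i)).degree < n) :
    (norm (∑ i ∈ s, z i)).degree < n := by
  refine Finset.sum_induction z (fun w => (norm w).degree < n) (fun a b ha hb => ?_) ?_ h
  · simp only [degree_norm_lt_iff hΦ he] at *
    exact ⟨fun j hj => by simp [ha.1 j hj, hb.1 j hj], fun j hj => by simp [ha.2 j hj, hb.2 j hj]⟩
  · simp

theorem norm_eq_zero_iff_of_odd {K : Type*} [Field K] {Φ : K[X]} {e g : ℕ}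
    (hΦ : Φ.natDegree = 2 * g + 1) (he : e ≤ g) (z : QuadraticAlgebra K[X] Φ (X ^ e)) :
    norm z = 0 ↔ z = 0 := by
  refine ⟨fun h => ?_, fun h => by simp [h]⟩
  have := (degree_norm_lt_iff hΦ he z 0).mp (by simp [h])
  ext j
  · simpa using this.1 j (by omega)
  · simpa using this.2 j (by omega)

/-- The element of norm-degree `s` in the standard monomial basis over `K`, where `D` is the degree
of the constant term of the defining equation. -/
noncomputable def monomialBasis {K : Type*} [Field K] {a b : K[X]} (D s : ℕ) :
    QuadraticAlgebra K[X] a b :=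
  if Even s then ⟨X ^ (s / 2), 0⟩ else ⟨0, X ^ ((s - D) / 2)⟩

/-- The coefficient of an element along `monomialBasis D s`. -/
noncomputable def monomialCoeff {K : Type*} [Field K] {a b : K[X]} (D s : ℕ) :
    QuadraticAlgebra K[X] a b →ₗ[K] K where
  toFun z := if Even s then z.re.coeff (s / 2) else z.im.coeff ((s - D) / 2)
  map_add' x y := by split_ifs <;> simp
  map_smul' c x := by split_ifs <;> simp

theorem degree_norm_monomialBasis {K : Type*} [Field K] {Φ : K[X]} {e g s : ℕ}
    (hΦ : Φ.natDegree = 2 * g + 1) (hs : Even s ∨ 2 * g + 1 ≤ s) :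
    (norm (monomialBasis (2 * g + 1) s : QuadraticAlgebra K[X] Φ (X ^ e))).degree = s := by
  have hΦ0 : Φ ≠ 0 := by rintro rfl; simp at hΦ
  rw [monomialBasis, norm_def]
  split_ifs with h
  · obtain ⟨k, rfl⟩ := h
    simp [← two_mul, ← pow_add]
  · have h' := hs.resolve_left h
    rw [Nat.not_even_iff_odd] at h
    obtain ⟨k, rfl⟩ := h
    have : (2 * k + 1 - (2 * g + 1)) / 2 = k - g := by omega
    simp only [this, mul_zero, zero_mul, add_zero, zero_sub, degree_neg]
    rw [mul_assoc, ← pow_add, degree_mul, degree_X_pow, degree_eq_natDegree hΦ0, hΦ]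
    norm_cast
    omega

theorem monomialCoeff_monomialBasis {K : Type*} [Field K] {a b : K[X]} {g s t : ℕ}
    (hs : Even s ∨ 2 * g + 1 ≤ s) (ht : Even t ∨ 2 * g + 1 ≤ t) :
    monomialCoeff (2 * g + 1) t (monomialBasis (2 * g + 1) s : QuadraticAlgebra K[X] a b) =
      if t = s then 1 else 0 := by
  simp only [monomialCoeff, monomialBasis, LinearMap.coe_mk, AddHom.coe_mk]
  by_cases h1 : Even s <;> by_cases h2 : Even t
  · simp only [h1, h2, if_true, coeff_X_pow]
    congr 1
    grind
  · simp only [h1, h2, if_true, if_false, coeff_zero]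
    rw [if_neg (by grind)]
  · simp only [h1, h2, if_true, if_false, coeff_zero]
    rw [if_neg (by grind)]
  · simp only [h1, h2, if_false, coeff_X_pow]
    congr 1
    grind

theorem eq_zero_of_monomialCoeff {K : Type*} [Field K] {Φ : K[X]} {e g n : ℕ}
    (hΦ : Φ.natDegree = 2 * g + 1) (he : e ≤ g) (z : QuadraticAlgebra K[X] Φ (X ^ e))
    (hz : (norm z).degree < n) (h : ∀ s < n, monomialCoeff (2 * g + 1) s z = 0) : z = 0 := by
  rw [degree_norm_lt_iff hΦ he] at hz
  ext j
  · by_cases hj : n ≤ 2 * j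
    · simpa using hz.1 j hj
    · simpa [monomialCoeff] using h (2 * j) (by omega)
  · by_cases hj : n ≤ 2 * j + (2 * g + 1)
    · simpa using hz.2 j hj
    · have := h (2 * j + (2 * g + 1)) (by omega)
      simpa [monomialCoeff, parity_simps] using this

/-- Evaluation of an element at a point of the affine curve. -/
noncomputable def evalPoint {K : Type*} [Field K] {a b : K[X]} (x y : K)
    (h : y * y = a.eval x + b.eval x * y) : QuadraticAlgebra K[X] a b →+* K where
  toFun z := z.re.eval x + z.im.eval x * y
  map_one' := by simp [re_one, im_one]
  map_zero' := by simp
  map_add' u v := by simp; ring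
  map_mul' u v := by
    simp only [re_mul, im_mul, eval_add, eval_mul]
    linear_combination (-(u.im.eval x * v.im.eval x)) * h

end QuadraticAlgebra

theorem sub_le_card_filter_even_or (n g : ℕ) :
    n - g ≤ #{s ∈ range n | Even s ∨ 2 * g + 1 ≤ s} := by
  have h := card_filter_add_card_filter_not (s := range n) (fun s => Even s ∨ 2 * g + 1 ≤ s)
  have h2 : #{s ∈ range n | ¬ (Even s ∨ 2 * g + 1 ≤ s)} ≤ #((range g).image (2 * · + 1)) := by
    refine card_le_card fun s hs => ?_
    simp only [mem_filter, mem_range, not_or, Nat.not_even_iff_odd, mem_image] at hs ⊢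
    obtain ⟨-, ⟨k, rfl⟩, h⟩ := hs
    exact ⟨k, by omega, rfl⟩
  have h3 := card_image_le (s := range g) (f := (2 * · + 1))
  simp only [card_range] at h h3
  omega

open QuadraticAlgebra in
/-- An auxiliary nonzero function of small degree on the curve `Y² = Φ + X ^ e Y` that vanishes at
all rational points. -/
theorem exists_ne_zero_degree_norm_lt_forall_evalPoint_eq_zero {K : Type*} [Field K] [Fintype K]
    [CharP K 2] {μ : ℕ} (hq : Fintype.card K = 2 * (2 ^ μ) ^ 2) {Φ : K[X]} {e g : ℕ}
    (hΦ : Φ.natDegree = 2 * g + 1) (he : e ≤ g) (hg0 : 1 ≤ g) (hg : g + 2 < 2 ^ μ) :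
    ∃ h : QuadraticAlgebra K[X] Φ (X ^ e), h ≠ 0 ∧
      (norm h).degree < ((2 * (2 ^ μ) ^ 2 + 4 * g * 2 ^ μ : ℕ) : WithBot ℕ) ∧
      ∀ (x y : K) (hxy : y * y = Φ.eval x + (X ^ e : K[X]).eval x * y), evalPoint x y hxy h = 0 := by
  classical
  set P := 2 ^ μ with hP
  set S : ℕ → Finset ℕ := fun n => {s ∈ range n | Even s ∨ 2 * g + 1 ≤ s} with hS
  set ε : ℕ → QuadraticAlgebra K[X] Φ (X ^ e) := monomialBasis (2 * g + 1) with hε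
  have memS : ∀ n s, s ∈ S n ↔ s < n ∧ (Even s ∨ 2 * g + 1 ≤ s) := by simp [hS]
  have hdeg : ∀ n, ∀ s ∈ S n, (norm (ε s)).degree = s := fun n s hs =>
    degree_norm_monomialBasis hΦ ((memS n s).1 hs).2
  have hsmul : ∀ (c : K) (z : QuadraticAlgebra K[X] Φ (X ^ e)), (norm (c • z)).degree ≤
      (norm z).degree := by
    intro c z
    have : norm (c • z) = C (c ^ 2) * norm z := by
      simp only [norm_def, re_smul, im_smul, smul_eq_C_mul, Polynomial.C_pow]
      ring
    rw [this, degree_mul]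
    calc _ ≤ 0 + (norm z).degree := by gcongr; exact degree_C_le
      _ = _ := zero_add _
  let N := 2 * P ^ 2 + 2 * g
  let Θ : (S (2 * P) × S (P + 2 * g) → K) →ₗ[K] (Fin N → K) :=
    LinearMap.pi fun s => (monomialCoeff (2 * g + 1) (s : ℕ)).comp
      (∑ p : S (2 * P) × S (P + 2 * g),
        (LinearMap.toSpanSingleton K _ (ε p.1 ^ P * ε p.2)).comp (LinearMap.proj p))
  have hker : ∃ d, d ≠ 0 ∧ Θ d = 0 := by
    have : LinearMap.ker Θ ≠ ⊥ := by
      apply LinearMap.ker_ne_bot_of_finrank_lt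
      rw [Module.finrank_fin_fun, Module.finrank_fintype_fun_eq_card, Fintype.card_prod,
        Fintype.card_coe, Fintype.card_coe]
      calc N < (2 * P - g) * (P + 2 * g - g) := by
            obtain ⟨k, hk⟩ := Nat.exists_eq_add_of_lt hg
            rw [show 2 * P - g = P + k + 3 by omega, show P + 2 * g - g = P + g by omega]
            simp only [N]
            rw [hk]
            nlinarith
        _ ≤ _ := Nat.mul_le_mul (sub_le_card_filter_even_or _ _) (sub_le_card_filter_even_or _ _)
    obtain ⟨d, hd, hd0⟩ := (Submodule.ne_bot_iff _).1 this
    exact ⟨d, hd0, hd⟩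
  obtain ⟨d, hd0, hd⟩ := hker
  have hrel : ∑ p : S (2 * P) × S (P + 2 * g), d p • (ε p.1 ^ P * ε p.2) = 0 := by
    refine eq_zero_of_monomialCoeff (n := N) hΦ he _ ?_ fun s hs => ?_
    · refine degree_norm_sum_lt hΦ he _ _ _ fun p _ => lt_of_le_of_lt (hsmul _ _) ?_
      rw [map_mul, map_pow, degree_mul, degree_pow, hdeg _ _ p.1.2, hdeg _ _ p.2.2]
      have h1 := ((memS _ _).1 p.1.2).1
      have h2 := ((memS _ _).1 p.2.2).1
      rw [nsmul_eq_mul]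
      norm_cast
      obtain ⟨k, hk⟩ := Nat.exists_eq_add_of_lt h1
      simp only [N]
      nlinarith
    · simpa [Θ] using congrFun hd ⟨s, hs⟩
  choose c hc using fun p => (bijective_iterateFrobenius K 2 μ).2 (d p)
  have hc' : ∀ p, c p ^ P = d p := fun p => by rw [← hc p, iterateFrobenius_def]
  let v : S (P + 2 * g) → QuadraticAlgebra K[X] Φ (X ^ e) := fun j => ∑ i, c (i, j) • ε i
  have hv : ∀ j, (norm (v j)).degree < ((2 * P : ℕ) : WithBot ℕ) := fun j =>
    degree_norm_sum_lt hΦ he _ _ _ fun i _ => lt_of_le_of_lt (hsmul _ _) <| by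
      rw [hdeg _ _ i.2]
      exact_mod_cast ((memS _ _).1 i.2).1
  have hvw : ∀ j, v j ≠ 0 → (((j : ℕ) * (2 * P) : ℕ) : WithBot ℕ) ≤
      (norm (v j * ε j ^ (2 * P))).degree := by
    intro j hj
    rw [map_mul, map_pow, degree_mul, degree_pow, hdeg _ _ j.2, nsmul_eq_mul,
      degree_eq_natDegree (by rwa [Ne, norm_eq_zero_iff_of_odd hΦ he])]
    norm_cast
    nlinarith
  have hvw' : ∀ j, (norm (v j * ε j ^ (2 * P))).degree <
      (((j + 1 : ℕ) * (2 * P) : ℕ) : WithBot ℕ) := by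
    intro j
    by_cases hj : v j = 0
    · simp only [hj, zero_mul, QuadraticAlgebra.norm_zero, degree_zero]
      exact WithBot.bot_lt_coe _
    have := hv j
    rw [degree_eq_natDegree (by rwa [Ne, norm_eq_zero_iff_of_odd hΦ he])] at this
    rw [map_mul, map_pow, degree_mul, degree_pow, hdeg _ _ j.2, nsmul_eq_mul,
      degree_eq_natDegree (by rwa [Ne, norm_eq_zero_iff_of_odd hΦ he])]
    norm_cast at this ⊢
    nlinarith
  refine ⟨∑ j, v j * ε j ^ (2 * P), fun h0 => ?_, ?_, fun x y hxy => ?_⟩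
  · have hne : ({j | v j ≠ 0} : Finset (S (P + 2 * g))).Nonempty := by
      by_contra hemp
      rw [not_nonempty_iff_eq_empty, filter_eq_empty_iff] at hemp
      refine hd0 (funext fun p => ?_)
      have h1 : v p.2 = 0 := by simpa using hemp (mem_univ p.2)
      have h2 := congrArg (monomialCoeff (2 * g + 1) (p.1 : ℕ)) h1
      simp only [v, map_sum, map_smul, map_zero, hε] at h2
      rw [sum_eq_single p.1] at h2
      · rw [monomialCoeff_monomialBasis ((memS _ _).1 p.1.2).2 ((memS _ _).1 p.1.2).2,
          if_pos rfl, smul_eq_mul, mul_one] at h2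
        rw [← hc' p, show c p = 0 from h2, zero_pow (by positivity)]
        rfl
      · intro i _ hi
        rw [monomialCoeff_monomialBasis ((memS _ _).1 i.2).2 ((memS _ _).1 p.1.2).2,
          if_neg (fun h => hi (Subtype.ext h.symm)), smul_zero]
      · simp
    obtain ⟨j, hj, hmax⟩ := exists_max_image _ (fun j : S (P + 2 * g) => (j : ℕ)) hne
    simp only [mem_filter, mem_univ, true_and] at hj hmax
    rw [← add_sum_erase _ _ (mem_univ j)] at h0
    have h1 := degree_norm_sum_lt hΦ he (univ.erase j) (fun j => v j * ε j ^ (2 * P))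
      ((j : ℕ) * (2 * P)) (fun i hi => by
        by_cases hi0 : v i = 0
        · simp only [hi0, zero_mul, QuadraticAlgebra.norm_zero, degree_zero]
          exact WithBot.bot_lt_coe _
        · refine lt_of_lt_of_le (hvw' i) ?_
          have h2 := hmax i hi0
          have h3 : (i : ℕ) ≠ j := fun h => (mem_erase.1 hi).1 (Subtype.ext h)
          have : (i : ℕ) + 1 ≤ j := by omega
          exact_mod_cast Nat.mul_le_mul_right _ this)
    rw [← neg_eq_of_add_eq_zero_right h0, QuadraticAlgebra.norm_neg] at h1
    exact absurd (hvw j hj) (not_le.2 h1)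
  · refine degree_norm_sum_lt hΦ he _ _ _ fun j _ => lt_of_lt_of_le (hvw' j) ?_
    have h1 := ((memS _ _).1 j.2).1
    have h2 : (j : ℕ) + 1 ≤ P + 2 * g := h1
    calc _ ≤ (((P + 2 * g) * (2 * P) : ℕ) : WithBot ℕ) := by
          exact_mod_cast Nat.mul_le_mul_right _ h2
      _ = _ := by congr 1; ring
  · have hφ : ∀ (a : K) z, evalPoint x y hxy (a • z) = a * evalPoint x y hxy z := by
      intro a z
      simp [evalPoint, smul_eq_C_mul]
      ring
    have h1 : (evalPoint x y hxy (∑ j, v j * ε j ^ (2 * P))) ^ P = 0 := by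
      rw [map_sum, sum_pow_char_pow]
      have h2 := congrArg (evalPoint x y hxy) hrel
      rw [map_sum, map_zero, Fintype.sum_prod_type_right] at h2
      rw [← h2]
      refine sum_congr rfl fun j _ => ?_
      rw [map_mul, map_pow, mul_pow, ← pow_mul, show 2 * P * P = Fintype.card K by rw [hq]; ring,
        FiniteField.pow_card, map_sum, sum_pow_char_pow, sum_mul]
      refine sum_congr rfl fun i _ => ?_
      rw [hφ, hφ, map_mul, map_pow, mul_pow, ← hP, hc', mul_assoc]
    exact eq_zero_of_pow_eq_zero h1

open QuadraticAlgebra in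
theorem two_mul_card_lt_of_forall_exists {K : Type*} [Field K] [Fintype K] [CharP K 2] {μ : ℕ}
    (hq : Fintype.card K = 2 * (2 ^ μ) ^ 2) {Φ : K[X]} {e g : ℕ}
    (hΦ : Φ.natDegree = 2 * g + 1) (he : e ≤ g) (hg0 : 1 ≤ g) (hg : g + 2 < 2 ^ μ)
    {Z : Finset K} (hZ : ∀ x ∈ Z, x ≠ 0 ∧ ∃ y, y * y = Φ.eval x + x ^ e * y) :
    2 * #Z < 2 * (2 ^ μ) ^ 2 + 4 * g * 2 ^ μ := by
  obtain ⟨h, h0, hdeg, hev⟩ :=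
    exists_ne_zero_degree_norm_lt_forall_evalPoint_eq_zero hq hΦ he hg0 hg
  have hroot : ∀ x ∈ Z, h.re.IsRoot x ∧ h.im.IsRoot x := by
    intro x hx
    obtain ⟨hx0, y, hy⟩ := hZ x hx
    have h2 : (2 : K) = 0 := CharTwo.two_eq_zero
    have e1 := hev x y (by simpa using hy)
    have e2 := hev x (y + x ^ e) (by
      simp only [eval_pow, eval_X]
      linear_combination hy + x ^ e * y * h2)
    simp only [evalPoint, RingHom.coe_mk, MonoidHom.coe_mk, OneHom.coe_mk] at e1 e2
    have e3 : h.im.eval x * x ^ e = 0 := by linear_combination e2 - e1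
    have e4 : h.im.eval x = 0 := (mul_eq_zero.1 e3).resolve_right (pow_ne_zero _ hx0)
    exact ⟨by simpa [e4] using e1, e4⟩
  have hcard : ∀ p : K[X], p ≠ 0 → (∀ x ∈ Z, p.IsRoot x) → #Z ≤ p.natDegree := fun p hp hr =>
    card_le_degree_of_subset_roots fun x hx => (mem_roots hp).2 (hr x hx)
  rw [degree_norm_lt_iff hΦ he] at hdeg
  by_cases hre : h.re = 0
  · have him : h.im ≠ 0 := fun him => h0 (by ext1 <;> simp [hre, him])
    have h1 := hcard _ him fun x hx => (hroot x hx).2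
    by_contra! h2
    exact him (leadingCoeff_eq_zero.1 (hdeg.2 _ (by omega)))
  · have h1 := hcard _ hre fun x hx => (hroot x hx).1
    by_contra! h2
    exact hre (leadingCoeff_eq_zero.1 (hdeg.1 _ (by omega)))

end Stepanov

section TraceSign

variable {K : Type*} [Field K] [Algebra (ZMod 2) K]

/-- The additive character `x ↦ (-1) ^ Tr x` of a field of characteristic two. -/
noncomputable def trSign (x : K) : ℤ := (-1) ^ (Algebra.trace (ZMod 2) K x).val

theorem neg_one_pow_val_add (a b : ZMod 2) :
    (-1 : ℤ) ^ (a + b).val = (-1) ^ a.val * (-1) ^ b.val := by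
  revert a b; decide

theorem trSign_add (x y : K) : trSign (x + y) = trSign x * trSign y := by
  simp [trSign, neg_one_pow_val_add]

@[simp] theorem trSign_zero : trSign (0 : K) = 1 := by simp [trSign]

theorem trSign_eq_one_or (x : K) : trSign x = 1 ∨ trSign x = -1 := neg_one_pow_eq_or ℤ _

variable [Fintype K]

theorem trSign_sq (x : K) : trSign (x ^ 2) = trSign x := by
  have h := Algebra.trace_eq_of_algEquiv
    (FiniteField.frobeniusAlgEquivOfAlgebraic (ZMod 2) K) x
  rw [FiniteField.coe_frobeniusAlgEquivOfAlgebraic, ZMod.card] at h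
  simp only [trSign, h]

theorem trSign_pow_two_pow (x : K) (n : ℕ) : trSign (x ^ 2 ^ n) = trSign x := by
  induction n with
  | zero => simp
  | succ n ih => rw [pow_succ, pow_mul, trSign_sq, ih]

theorem trSign_one (h : Odd (Module.finrank (ZMod 2) K)) : trSign (1 : K) = -1 := by
  have h1 : Algebra.trace (ZMod 2) K 1 = 1 := by
    have := Algebra.trace_algebraMap (R := ZMod 2) (S := K) 1
    rw [map_one] at this
    rw [this]
    obtain ⟨k, hk⟩ := h
    rw [hk]
    simp only [nsmul_eq_mul, Nat.cast_add, Nat.cast_mul, Nat.cast_ofNat]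
    rw [show (2 : ZMod 2) = 0 from rfl]
    simp
  rw [trSign, h1]
  rfl

theorem sum_trSign_mul [DecidableEq K] (z : K) :
    ∑ x : K, trSign (z * x) = if z = 0 then (Fintype.card K : ℤ) else 0 := by
  split_ifs with hz
  · simp [hz]
  obtain ⟨b, hb⟩ : ∃ b, Algebra.trace (ZMod 2) K (z * b) ≠ 0 := by
    by_contra! h
    exact hz ((traceForm_nondegenerate (ZMod 2) K).1 z h)
  have hb' : trSign (z * b) = -1 := by
    have : ∀ a : ZMod 2, a ≠ 0 → (-1 : ℤ) ^ a.val = -1 := by decide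
    exact this _ hb
  have h := Fintype.sum_equiv (Equiv.addRight b) (fun x => trSign (z * (x + b)))
    (fun x => trSign (z * x)) (fun x => rfl)
  simp only [mul_add, trSign_add, hb', mul_neg, mul_one, sum_neg_distrib] at h
  linarith

/-- Additive Hilbert 90 in characteristic two, in counting form. -/
theorem card_sq_add_self_eq [CharP K 2] [DecidableEq K] (d : K) :
    (#{y : K | y ^ 2 + y = d} : ℤ) = 1 + trSign d := by
  have h2 : (2 : K) = 0 := CharTwo.two_eq_zero
  have hq : (Fintype.card K : ℤ) ≠ 0 := by exact_mod_cast Fintype.card_ne_zero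
  apply mul_left_cancel₀ hq
  have e1 : ∑ y : K, ∑ z : K, trSign ((y ^ 2 + y + d) * z) =
      Fintype.card K * #{y : K | y ^ 2 + y = d} := by
    simp_rw [sum_trSign_mul]
    rw [← sum_filter, sum_const, nsmul_eq_mul, mul_comm]
    congr 3
    ext y
    simp only [mem_filter, mem_univ, true_and]
    rw [← CharTwo.sub_eq_add, sub_eq_zero]
  have e2 : ∀ y z : K, trSign ((y ^ 2 + y + d) * z) =
      trSign (d * z) * trSign ((z + z ^ 2) * y ^ 2) := by
    intro y z
    rw [show (y ^ 2 + y + d) * z = d * z + z * y ^ 2 + y * z by ring, trSign_add, ← trSign_sq (y * z),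
      ← trSign_add, ← trSign_add]
    congr 1
    ring
  have e3 : ∀ z : K, ∑ y : K, trSign ((z + z ^ 2) * y ^ 2) =
      if z = 0 ∨ z = 1 then (Fintype.card K : ℤ) else 0 := by
    intro z
    have h := (bijective_frobenius K 2).sum_comp (fun y => trSign ((z + z ^ 2) * y))
    simp only [frobenius_def] at h
    rw [h, sum_trSign_mul]
    congr 1
    rw [show z + z ^ 2 = z * (z - 1) by linear_combination z * h2]
    simp [sub_eq_zero]
  rw [← e1, sum_comm]
  simp_rw [e2, ← mul_sum, e3, mul_ite, mul_zero]
  rw [← sum_filter, show (univ.filter fun z : K => z = 0 ∨ z = 1) = {0, 1} by ext; simp,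
    sum_pair zero_ne_one]
  simp
  ring

open Polynomial

theorem sum_trSign_le [CharP K 2] [DecidableEq K] {μ : ℕ}
    (hq : Fintype.card K = 2 * (2 ^ μ) ^ 2)
    {Φ : K[X]} {e g : ℕ} (hΦ : Φ.natDegree = 2 * g + 1) (he : e ≤ g) (hg0 : 1 ≤ g)
    (hg : g + 2 < 2 ^ μ) :
    ∑ t ∈ univ.erase (0 : K), trSign (Φ.eval t / t ^ (2 * e)) ≤ 4 * g * 2 ^ μ := by
  set F : K → ℤ := fun t => trSign (Φ.eval t / t ^ (2 * e)) with hF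
  have h1 : ∀ t, F t = 2 * (if F t = 1 then 1 else 0) - 1 := by
    intro t
    rcases trSign_eq_one_or (Φ.eval t / t ^ (2 * e)) with h | h <;> simp [hF, h]
  rw [sum_congr rfl fun t _ => h1 t, sum_sub_distrib, ← mul_sum, ← sum_filter, sum_const,
    sum_const, card_erase_of_mem (mem_univ _), card_univ, hq]
  have h2 := two_mul_card_lt_of_forall_exists (Z := {t ∈ univ.erase (0 : K) | F t = 1}) hq hΦ he
    hg0 hg fun t ht => by
      rw [mem_filter, mem_erase] at ht
      refine ⟨ht.1.1, ?_⟩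
      have h3 := card_sq_add_self_eq (Φ.eval t / t ^ (2 * e))
      rw [show trSign (Φ.eval t / t ^ (2 * e)) = 1 from ht.2] at h3
      obtain ⟨y, hy⟩ : ({y : K | y ^ 2 + y = Φ.eval t / t ^ (2 * e)} : Finset K).Nonempty :=
        card_pos.1 (by omega)
      rw [mem_filter] at hy
      have h4 : (y ^ 2 + y) * t ^ (2 * e) = Φ.eval t := by
        rw [hy.2, div_mul_cancel₀ _ (pow_ne_zero _ ht.1.1)]
      refine ⟨y * t ^ e, ?_⟩
      rw [← h4]
      linear_combination -y * t ^ (2 * e) * (CharTwo.two_eq_zero : (2 : K) = 0)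
  have h5 : 1 ≤ 2 * (2 ^ μ) ^ 2 := Nat.one_le_iff_ne_zero.2 (by positivity)
  zify at h2
  rw [nsmul_eq_mul, nsmul_eq_mul, mul_one, mul_one, Nat.cast_sub h5]
  push_cast
  linarith

theorem abs_sum_trSign_le [CharP K 2] [DecidableEq K] {μ : ℕ}
    (hq : Fintype.card K = 2 * (2 ^ μ) ^ 2) (h1 : trSign (1 : K) = -1)
    {Φ : K[X]} {e g : ℕ} (hΦ : Φ.natDegree = 2 * g + 1) (he : e ≤ g) (hg0 : 1 ≤ g)
    (hg : g + 2 < 2 ^ μ) :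
    |∑ t ∈ univ.erase (0 : K), trSign (Φ.eval t / t ^ (2 * e))| ≤ 4 * g * 2 ^ μ := by
  refine abs_le.2 ⟨?_, sum_trSign_le hq hΦ he hg0 hg⟩
  have h2 := sum_trSign_le hq (Φ := Φ + X ^ (2 * e)) (e := e)
    (by rw [natDegree_add_eq_left_of_natDegree_lt, hΦ]; rw [natDegree_X_pow]; omega) he hg0 hg
  rw [sum_congr rfl fun t ht => show _ = -trSign (Φ.eval t / t ^ (2 * e)) by
    rw [eval_add, eval_pow, eval_X, add_div, div_self (pow_ne_zero _ (mem_erase.1 ht).1),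
      trSign_add, h1]; ring, sum_neg_distrib] at h2
  linarith

theorem abs_sum_trSign_le_of_le [CharP K 2] [DecidableEq K] {μ : ℕ}
    (hq : Fintype.card K = 2 * (2 ^ μ) ^ 2) (h1 : trSign (1 : K) = -1)
    {Φ : K[X]} {e g τ : ℕ} (hΦ : Φ.natDegree = 2 * g + 1) (he : e ≤ g) (hg0 : 1 ≤ g)
    (hτ : 1 ≤ τ) (hg : g ≤ 7 * τ) :
    |∑ t ∈ univ.erase (0 : K), trSign (Φ.eval t / t ^ (2 * e))| ≤ 28 * τ * 2 ^ μ := by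
  rcases lt_or_ge (g + 2) (2 ^ μ) with h | h
  · refine (abs_sum_trSign_le hq h1 hΦ he hg0 h).trans ?_
    have : (g : ℤ) ≤ 7 * τ := by exact_mod_cast hg
    gcongr ?_ * 2 ^ μ
    linarith
  · have h3 : (2 : ℤ) ^ μ ≤ 9 * τ := by
      have : 2 ^ μ ≤ 9 * τ := by omega
      exact_mod_cast this
    calc _ ≤ ∑ t ∈ univ.erase (0 : K), |trSign (Φ.eval t / t ^ (2 * e))| := abs_sum_le_sum_abs _ _
      _ ≤ ∑ t ∈ univ.erase (0 : K), 1 := sum_le_sum fun t _ => by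
          rcases trSign_eq_one_or (Φ.eval t / t ^ (2 * e)) with h | h <;> simp [h]
      _ ≤ (Fintype.card K : ℤ) := by
          rw [sum_const, nsmul_eq_mul, mul_one]
          exact_mod_cast card_le_univ _
      _ = 2 * 2 ^ μ * 2 ^ μ := by rw [hq]; push_cast; ring
      _ ≤ 28 * τ * 2 ^ μ := by gcongr ?_ * 2 ^ μ; linarith

end TraceSign

section FourthMoment

variable {K : Type*} [Field K] [Algebra (ZMod 2) K] [Fintype K] [CharP K 2]

theorem sum_walsh_pow_four [DecidableEq K] (f : K → ℤ) :
    ∑ v : K, (∑ x, f x * trSign (v * x)) ^ 4 =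
      Fintype.card K * ∑ α : K, ∑ β : K, ∑ x, f x * f (x + α) * f (x + β) * f (x + α + β) := by
  have hsq : ∀ v : K, (∑ x, f x * trSign (v * x)) ^ 2 =
      ∑ α : K, (∑ x, f x * f (x + α)) * trSign (v * α) := by
    intro v
    rw [sq, sum_mul_sum]
    simp_rw [sum_mul]
    conv_rhs => rw [sum_comm]
    refine sum_congr rfl fun x _ => ?_
    refine Fintype.sum_equiv (Equiv.addLeft x) _ _ (fun α => ?_) |>.symm
    simp only [Equiv.coe_addLeft]
    rw [show v * α = v * x + v * (x + α) by
      linear_combination (-v * x) * (CharTwo.two_eq_zero : (2 : K) = 0), trSign_add]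
    ring
  have hauto : ∀ α : K, (∑ x, f x * f (x + α)) ^ 2 =
      ∑ β : K, ∑ x, f x * f (x + α) * f (x + β) * f (x + α + β) := by
    intro α
    rw [sq, sum_mul_sum, sum_comm (γ := K) (s := univ) (t := univ) (f := fun β x =>
      f x * f (x + α) * f (x + β) * f (x + α + β))]
    refine sum_congr rfl fun x _ => ?_
    refine (Fintype.sum_equiv (Equiv.addLeft x) _ _ fun β => ?_).symm
    simp only [Equiv.coe_addLeft]
    rw [add_right_comm x α β]
    ring
  simp_rw [← hauto, show ∀ v : K, (∑ x, f x * trSign (v * x)) ^ 4 =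
    ((∑ x, f x * trSign (v * x)) ^ 2) ^ 2 from fun v => by ring, hsq]
  obtain ⟨A, hA⟩ : ∃ A : K → ℤ, ∀ α, ∑ x, f x * f (x + α) = A α := ⟨_, fun _ => rfl⟩
  simp_rw [hA]
  have hv : ∀ v : K, (∑ α, A α * trSign (v * α)) ^ 2 =
      ∑ α, ∑ β, A α * A β * trSign ((α + β) * v) := by
    intro v
    rw [sq, sum_mul_sum]
    refine sum_congr rfl fun α _ => sum_congr rfl fun β _ => ?_
    rw [show (α + β) * v = v * α + v * β by ring, trSign_add]
    ring
  simp_rw [hv]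
  rw [sum_comm, mul_sum]
  refine sum_congr rfl fun α _ => ?_
  rw [sum_comm]
  simp_rw [← mul_sum, sum_trSign_mul, CharTwo.add_eq_zero]
  simp
  ring

/-- The second derivative of `a x ^ 7` plus a quadratic form, up to the trace. -/
theorem trSign_second_derivative {a : K} {b : ℕ → K} {s : ℕ} {G : K → K}
    (hG : ∀ x, G x = a * x ^ 7 + ∑ i ∈ Icc 1 s, b i * x ^ (2 ^ i + 1)) (α β x : K) :
    trSign (G x) * trSign (G (x + α)) * trSign (G (x + β)) * trSign (G (x + α + β)) =
      trSign (G α + G β + G (α + β)) *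
        trSign ((a ^ 4 * (α * β * (α + β)) ^ 8 + a ^ 2 * (α * β * (α + β)) ^ 2 *
          (α ^ 2 + α * β + β ^ 2) ^ 2 + a * (α * β * (α + β))) * x ^ 4) := by
  have h2 : (2 : K) = 0 := CharTwo.two_eq_zero
  set u := α * β * (α + β)
  set v := α ^ 2 + α * β + β ^ 2
  have h1 : trSign ((a ^ 4 * u ^ 8 + a ^ 2 * u ^ 2 * v ^ 2 + a * u) * x ^ 4) =
      trSign (a * (u ^ 2 * x + u * v * x ^ 2 + u * x ^ 4)) := by
    rw [show (a ^ 4 * u ^ 8 + a ^ 2 * u ^ 2 * v ^ 2 + a * u) * x ^ 4 =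
      (a * u ^ 2 * x) ^ 2 ^ 2 + (a * u * v * x ^ 2) ^ 2 + a * u * x ^ 4 by ring, trSign_add,
      trSign_add, trSign_pow_two_pow, trSign_sq, ← trSign_add, ← trSign_add]
    congr 1
    ring
  rw [h1, ← trSign_add, ← trSign_add, ← trSign_add, ← trSign_add]
  congr 1
  have hb : ∑ i ∈ Icc 1 s, (b i * x ^ (2 ^ i + 1) + b i * (x + α) ^ (2 ^ i + 1) +
      b i * (x + β) ^ (2 ^ i + 1) + b i * (x + α + β) ^ (2 ^ i + 1)) =
      ∑ i ∈ Icc 1 s, (b i * α ^ (2 ^ i + 1) + b i * β ^ (2 ^ i + 1) +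
      b i * (α + β) ^ (2 ^ i + 1)) := by
    refine sum_congr rfl fun i _ => ?_
    simp only [add_pow_char_pow, pow_succ]
    ring_nf
    linear_combination b i * (x ^ 2 ^ i * x * 2 + x ^ 2 ^ i * α + x ^ 2 ^ i * β + x * α ^ 2 ^ i +
      x * β ^ 2 ^ i) * h2
  simp only [sum_add_distrib] at hb
  have ha : x ^ 7 + (x + α) ^ 7 + (x + β) ^ 7 + (x + α + β) ^ 7 =
      α ^ 7 + β ^ 7 + (α + β) ^ 7 + (u ^ 2 * x + u * v * x ^ 2 + u * x ^ 4) := by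
    grind
  simp only [hG]
  linear_combination a * ha + hb

theorem sum_walsh_pow_four_eq_sum_ite [DecidableEq K] {a c : K} (hc : c ^ 2 = a) (hc0 : c ≠ 0)
    {b : ℕ → K} {s : ℕ} {G : K → K}
    (hG : ∀ x, G x = a * x ^ 7 + ∑ i ∈ Icc 1 s, b i * x ^ (2 ^ i + 1)) {r : K → K}
    (hr : ∀ x, r x ^ 2 = x) :
    ∑ v : K, (∑ x, trSign (G x) * trSign (v * x)) ^ 4 =
      (Fintype.card K) ^ 2 * ∑ p : K × K, if (p.1 + c * r (p.1 * p.2 * (p.1 + p.2)) ^ 3) *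
        (p.2 + c * r (p.1 * p.2 * (p.1 + p.2)) ^ 3) *
        (p.1 + p.2 + c * r (p.1 * p.2 * (p.1 + p.2)) ^ 3) = 0
      then trSign (G p.1 + G p.2 + G (p.1 + p.2)) else 0 := by
  have h2 : (2 : K) = 0 := CharTwo.two_eq_zero
  rw [sum_walsh_pow_four, sq, mul_assoc, Fintype.sum_prod_type]
  congr 1
  rw [mul_sum]
  refine sum_congr rfl fun α _ => ?_
  rw [mul_sum]
  refine sum_congr rfl fun β _ => ?_
  dsimp only
  simp_rw [trSign_second_derivative hG, ← mul_sum]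
  have hb : Function.Bijective fun x : K => x ^ 4 := by
    convert! bijective_iterateFrobenius K 2 2 using 1
  have h4 := fun z : K => hb.sum_comp fun y => trSign (z * y)
  rw [h4, sum_trSign_mul, mul_ite, mul_zero, mul_ite, mul_zero, mul_comm (Fintype.card K : ℤ)]
  refine if_congr ?_ rfl rfl
  set t := r (α * β * (α + β)) with ht
  have htu : α * β * (α + β) = t ^ 2 := (hr _).symm
  have e1 : (α + c * t ^ 3) * (β + c * t ^ 3) * (α + β + c * t ^ 3) =
      t ^ 2 * (c ^ 3 * t ^ 7 + c * t * (α ^ 2 + α * β + β ^ 2) + 1) := by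
    linear_combination htu + (c * t ^ 3 * α * β + c ^ 2 * t ^ 6 * (α + β)) * h2
  have e2 : a ^ 4 * (α * β * (α + β)) ^ 8 + a ^ 2 * (α * β * (α + β)) ^ 2 *
      (α ^ 2 + α * β + β ^ 2) ^ 2 + a * (α * β * (α + β)) =
      c ^ 2 * (t ^ 2 * (c ^ 3 * t ^ 7 + c * t * (α ^ 2 + α * β + β ^ 2) + 1) ^ 2) := by
    rw [htu, ← hc]
    generalize α ^ 2 + α * β + β ^ 2 = v
    grind
  rw [e1, e2]
  simp [hc0]

end FourthMoment

section PairSum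

variable {K : Type*} [Field K] [Fintype K] [CharP K 2] [DecidableEq K]

theorem sum_ite_mul_mul_add_eq_zero :
    ∑ p : K × K, (if p.1 * p.2 * (p.1 + p.2) = 0 then (1 : ℤ) else 0) =
      3 * Fintype.card K - 2 := by
  have h : ∀ α : K, ∑ β, (if α * β * (α + β) = 0 then (1 : ℤ) else 0) =
      2 + if α = 0 then (Fintype.card K : ℤ) - 2 else 0 := by
    intro α
    by_cases hα : α = 0
    · simp [hα]
    · simp only [mul_eq_zero, hα, false_or, if_false, add_zero, CharTwo.add_eq_zero]
      rw [← sum_filter, show (univ.filter fun β : K => β = 0 ∨ α = β) = {0, α} by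
        ext; simp [eq_comm], sum_pair (Ne.symm hα)]
      rfl
  rw [Fintype.sum_prod_type]
  simp_rw [h, sum_add_distrib]
  simp
  ring

theorem sum_ite_fst_eq {c : K} (hc0 : c ≠ 0) {r : K → K} (hr : ∀ x, r x ^ 2 = x) (F : K → K → ℤ) :
    ∑ p : K × K, (if p.1 * p.2 * (p.1 + p.2) ≠ 0 ∧
        p.1 = c * r (p.1 * p.2 * (p.1 + p.2)) ^ 3 then F p.1 p.2 else 0) =
      ∑ t ∈ univ.erase (0 : K), ∑ ρ : K with ρ ^ 2 + ρ = (c ^ 3 * t ^ 7)⁻¹,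
        F (c * t ^ 3) (c * t ^ 3 * ρ) := by
  have hrt : ∀ t, r (t ^ 2) = t := fun t => (CharTwo.sq_injective (hr (t ^ 2)))
  have hu : ∀ {t ρ : K}, t ≠ 0 → ρ ^ 2 + ρ = (c ^ 3 * t ^ 7)⁻¹ →
      c * t ^ 3 * (c * t ^ 3 * ρ) * (c * t ^ 3 + c * t ^ 3 * ρ) = t ^ 2 := by
    intro t ρ ht h
    have : (ρ ^ 2 + ρ) * (c ^ 3 * t ^ 7) = 1 := by
      rw [h, inv_mul_cancel₀ (by positivity)]
    linear_combination t ^ 2 * this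
  rw [← sum_filter, sum_sigma']
  refine sum_bij' (fun p _ => ⟨r (p.1 * p.2 * (p.1 + p.2)), p.2 / p.1⟩)
    (fun x _ => (c * x.1 ^ 3, c * x.1 ^ 3 * x.2)) ?_ ?_ ?_ ?_ ?_
  · rintro ⟨α, β⟩ h
    simp only [mem_filter, mem_univ, true_and] at h
    obtain ⟨h0, h1⟩ := h
    have hα : α ≠ 0 := by rintro rfl; simp at h0
    have ht := hr (α * β * (α + β))
    set t := r (α * β * (α + β))
    have ht0 : t ≠ 0 := by rintro h; rw [h] at ht; simp at ht; grind
    simp only [mem_sigma, mem_erase, mem_univ, and_true, mem_filter, true_and]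
    refine ⟨ht0, ?_⟩
    refine eq_inv_of_mul_eq_one_left ?_
    have h3 : α ^ 3 = c ^ 3 * t ^ 9 := by rw [h1]; ring
    apply mul_right_cancel₀ (pow_ne_zero 2 ht0)
    have hx : ((β / α) ^ 2 + β / α) * α ^ 3 = α * β * (α + β) := by field_simp; ring
    linear_combination (-((β / α) ^ 2 + β / α)) * h3 + hx - ht
  · rintro ⟨t, ρ⟩ h
    simp only [mem_sigma, mem_erase, mem_univ, and_true, mem_filter, true_and] at h
    simp only [mem_filter, mem_univ, true_and]
    rw [hu h.1 h.2, hrt]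
    exact ⟨pow_ne_zero 2 h.1, rfl⟩
  · rintro ⟨α, β⟩ h
    simp only [mem_filter, mem_univ, true_and] at h
    obtain ⟨h0, h1⟩ := h
    have hα : α ≠ 0 := by rintro rfl; simp at h0
    simp only [← h1]
    rw [mul_div_cancel₀ _ hα]
  · rintro ⟨t, ρ⟩ h
    simp only [mem_sigma, mem_erase, mem_univ, and_true, mem_filter, true_and] at h
    simp only [hu h.1 h.2, hrt]
    rw [mul_div_cancel_left₀ _ (by simp [hc0, h.1])]
  · rintro ⟨α, β⟩ h
    simp only [mem_filter, mem_univ, true_and] at h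
    obtain ⟨h0, h1⟩ := h
    have hα : α ≠ 0 := by rintro rfl; simp at h0
    simp only [← h1]
    rw [mul_div_cancel₀ _ hα]

theorem sum_ite_prod_eq_zero {c : K} (hc0 : c ≠ 0) {r : K → K} (hr : ∀ x, r x ^ 2 = x)
    {F : K → K → ℤ} (hcomm : ∀ α β, F α β = F β α) (hadd : ∀ α β, F (α + β) β = F α β)
    (hF : ∀ α β, α * β * (α + β) = 0 → F α β = 1) :
    ∑ p : K × K, (if (p.1 + c * r (p.1 * p.2 * (p.1 + p.2)) ^ 3) *
        (p.2 + c * r (p.1 * p.2 * (p.1 + p.2)) ^ 3) *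
        (p.1 + p.2 + c * r (p.1 * p.2 * (p.1 + p.2)) ^ 3) = 0 then F p.1 p.2 else 0) =
      3 * Fintype.card K - 2 +
        3 * ∑ t ∈ univ.erase (0 : K), ∑ ρ : K with ρ ^ 2 + ρ = (c ^ 3 * t ^ 7)⁻¹,
          F (c * t ^ 3) (c * t ^ 3 * ρ) := by
  set u : K × K → K := fun p => p.1 * p.2 * (p.1 + p.2) with hu
  set k : K × K → K := fun p => c * r (u p) ^ 3 with hk
  have hsplit : ∀ p : K × K,
      (if (p.1 + k p) * (p.2 + k p) * (p.1 + p.2 + k p) = 0 then F p.1 p.2 else 0) =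
      (if u p = 0 then 1 else 0) + (if u p ≠ 0 ∧ p.1 = k p then F p.1 p.2 else 0) +
        (if u p ≠ 0 ∧ p.2 = k p then F p.1 p.2 else 0) +
        (if u p ≠ 0 ∧ p.1 + p.2 = k p then F p.1 p.2 else 0) := by
    rintro ⟨α, β⟩
    by_cases h0 : u (α, β) = 0
    · have hr0 : r 0 = 0 := by simpa using hr 0
      have hk0 : k (α, β) = 0 := by simp [hk, h0, hr0]
      have h0' : α * β * (α + β) = 0 := h0
      simp only [hk0, add_zero, h0', hF α β h0', h0]
      simp
    · have h0' : α * β * (α + β) ≠ 0 := h0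
      simp only [mul_eq_zero, CharTwo.add_eq_zero (R := K), h0, ne_eq, not_false_eq_true, true_and,
        if_false]
      have hα : α ≠ 0 := by rintro rfl; simp at h0'
      have hβ : β ≠ 0 := by rintro rfl; simp at h0'
      have hαβ : α ≠ β := by
        rintro rfl
        simp [CharTwo.add_self_eq_zero] at h0'
      by_cases h1 : α = k (α, β)
      · simp [h1.symm, hαβ.symm, hβ]
      · by_cases h2 : β = k (α, β)
        · simp [h2.symm, hαβ, hα]
        · simp [h1, h2]
  have hsnd : ∑ p : K × K, (if u p ≠ 0 ∧ p.2 = k p then F p.1 p.2 else 0) =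
      ∑ p : K × K, (if u p ≠ 0 ∧ p.1 = k p then F p.1 p.2 else 0) := by
    refine Fintype.sum_equiv (Equiv.prodComm K K) _ _ ?_
    rintro ⟨α, β⟩
    have : u (β, α) = u (α, β) := by simp only [hu]; ring
    simp [hk, this, hcomm β α]
  have hsum : ∑ p : K × K, (if u p ≠ 0 ∧ p.1 + p.2 = k p then F p.1 p.2 else 0) =
      ∑ p : K × K, (if u p ≠ 0 ∧ p.1 = k p then F p.1 p.2 else 0) := by
    have hinv : Function.Involutive fun p : K × K => (p.1 + p.2, p.2) := by
      rintro ⟨α, β⟩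
      simp [add_assoc, CharTwo.add_self_eq_zero]
    refine Fintype.sum_equiv hinv.toPerm _ _ ?_
    rintro ⟨α, β⟩
    have : u (α + β, β) = u (α, β) := by
      simp only [hu, add_assoc, CharTwo.add_self_eq_zero]; ring
    simp [hk, this, hadd α β]
  have hfst := sum_ite_fst_eq hc0 hr F
  have h0 := sum_ite_mul_mul_add_eq_zero (K := K)
  calc _ = ∑ p : K × K, _ := sum_congr rfl fun p _ => hsplit p
    _ = _ := by
      rw [sum_add_distrib, sum_add_distrib, sum_add_distrib, hsnd, hsum, ← hfst, ← h0]
      ring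

end PairSum

section Reduction

variable {K : Type*} [Field K] [CharP K 2]

theorem pow_two_pow_add_self_eq_sum {ρ δ : K} (h : ρ ^ 2 + ρ = δ) (i : ℕ) :
    ρ ^ 2 ^ i + ρ = ∑ j ∈ range i, δ ^ 2 ^ j := by
  induction i with
  | zero => simp [CharTwo.add_self_eq_zero]
  | succ i ih =>
    rw [sum_range_succ, ← ih, ← h, add_pow_char_pow, ← pow_mul, ← pow_succ']
    linear_combination (-ρ ^ 2 ^ i) * (CharTwo.two_eq_zero : (2 : K) = 0)

/-- The quadratic part of the first derivative of `G` in direction `(c t ^ 3, c t ^ 3 ρ)`,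
where `ρ ^ 2 + ρ = (c ^ 3 t ^ 7)⁻¹`. -/
def quadraticPart (b : ℕ → K) (s : ℕ) (c t : K) : K :=
  ∑ i ∈ Icc 1 s, b i * (c * t ^ 3) ^ (2 ^ i + 1) * ∑ j ∈ range i, (c ^ 3 * t ^ 7)⁻¹ ^ 2 ^ j

theorem add_add_eq_quadraticPart {a c : K} (hc : c ^ 2 = a) (hc0 : c ≠ 0) {b : ℕ → K} {s : ℕ}
    {G : K → K} (hG : ∀ x, G x = a * x ^ 7 + ∑ i ∈ Icc 1 s, b i * x ^ (2 ^ i + 1))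
    {t ρ : K} (ht : t ≠ 0) (hρ : ρ ^ 2 + ρ = (c ^ 3 * t ^ 7)⁻¹) :
    G (c * t ^ 3) + G (c * t ^ 3 * ρ) + G (c * t ^ 3 + c * t ^ 3 * ρ) =
      (c ^ 3 * t ^ 7) ^ 2 + 1 + quadraticPart b s c t := by
  have h2 : (2 : K) = 0 := CharTwo.two_eq_zero
  have hb : ∑ i ∈ Icc 1 s, (b i * (c * t ^ 3) ^ (2 ^ i + 1) +
      b i * (c * t ^ 3 * ρ) ^ (2 ^ i + 1) + b i * (c * t ^ 3 + c * t ^ 3 * ρ) ^ (2 ^ i + 1)) =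
      quadraticPart b s c t := by
    refine sum_congr rfl fun i _ => ?_
    rw [← pow_two_pow_add_self_eq_sum hρ, show c * t ^ 3 + c * t ^ 3 * ρ = c * t ^ 3 * (1 + ρ) by
      ring, mul_pow _ ρ, mul_pow _ (1 + ρ), pow_succ (1 + ρ), add_pow_char_pow, one_pow,
      pow_succ ρ]
    linear_combination b i * (c * t ^ 3) ^ (2 ^ i + 1) * (1 + ρ ^ 2 ^ i * ρ) * h2
  simp only [sum_add_distrib] at hb
  have hδ : (ρ ^ 2 + ρ) * (c ^ 3 * t ^ 7) = 1 := by
    rw [hρ, inv_mul_cancel₀ (by simp [hc0, ht])]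
  have ha : (1 : K) + ρ ^ 7 + (1 + ρ) ^ 7 = (ρ ^ 2 + ρ) * ((ρ ^ 2 + ρ) ^ 2 + 1) := by
    grind
  have h7 : a * (c * t ^ 3) ^ 7 + a * (c * t ^ 3 * ρ) ^ 7 +
      a * (c * t ^ 3 + c * t ^ 3 * ρ) ^ 7 = (c ^ 3 * t ^ 7) ^ 2 + 1 := by
    have e : a * (c * t ^ 3) ^ 7 = (c ^ 3 * t ^ 7) ^ 3 := by rw [← hc]; ring
    have e' : a * (c * t ^ 3) ^ 7 + a * (c * t ^ 3 * ρ) ^ 7 +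
      a * (c * t ^ 3 + c * t ^ 3 * ρ) ^ 7 = a * (c * t ^ 3) ^ 7 * (1 + ρ ^ 7 + (1 + ρ) ^ 7) := by
      ring
    rw [e', e, ha]
    generalize ρ ^ 2 + ρ = δ at *
    generalize c ^ 3 * t ^ 7 = w at *
    linear_combination (δ ^ 2 * w ^ 2 + δ * w + 1 + w ^ 2) * hδ
  simp only [hG]
  linear_combination h7 + hb

variable [Algebra (ZMod 2) K] [Fintype K] [DecidableEq K]

theorem sum_walsh_pow_four_eq {a c : K} (hc : c ^ 2 = a) (hc0 : c ≠ 0)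
    (h1 : trSign (1 : K) = -1) {b : ℕ → K} {s : ℕ} {G : K → K}
    (hG : ∀ x, G x = a * x ^ 7 + ∑ i ∈ Icc 1 s, b i * x ^ (2 ^ i + 1)) :
    ∑ v : K, (∑ x, trSign (G x) * trSign (v * x)) ^ 4 =
      (Fintype.card K) ^ 2 * (3 * Fintype.card K - 2 -
        3 * (∑ t ∈ univ.erase (0 : K), trSign (c ^ 3 * t ^ 7 + quadraticPart b s c t) +
          ∑ t ∈ univ.erase (0 : K),
            trSign (c ^ 3 * t ^ 7 + (c ^ 3 * t ^ 7)⁻¹ + quadraticPart b s c t))) := by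
  choose r hr using fun x : K => (bijective_frobenius K 2).surjective x
  simp only [frobenius_def] at hr
  have hG0 : G 0 = 0 := by simp [hG]
  rw [sum_walsh_pow_four_eq_sum_ite hc hc0 hG hr, sum_ite_prod_eq_zero hc0 hr
    (F := fun α β => trSign (G α + G β + G (α + β)))]
  · congr 1
    rw [← sum_add_distrib, sub_eq_add_neg _ (3 * _), ← mul_neg, ← sum_neg_distrib]
    congr 2
    refine sum_congr rfl fun t ht => ?_
    have hE : ∀ ρ ∈ ({ρ : K | ρ ^ 2 + ρ = (c ^ 3 * t ^ 7)⁻¹} : Finset K),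
        trSign (G (c * t ^ 3) + G (c * t ^ 3 * ρ) + G (c * t ^ 3 + c * t ^ 3 * ρ)) =
          -trSign (c ^ 3 * t ^ 7 + quadraticPart b s c t) := by
      intro ρ hρ
      rw [add_add_eq_quadraticPart hc hc0 hG (mem_erase.1 ht).1 (mem_filter.1 hρ).2, trSign_add,
        trSign_add, trSign_sq, h1, trSign_add]
      ring
    rw [sum_congr rfl hE, sum_const, nsmul_eq_mul, card_sq_add_self_eq, add_right_comm (c ^ 3 * _),
      trSign_add _ (c ^ 3 * t ^ 7)⁻¹]
    ring
  · intro α β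
    rw [add_comm (G α), add_comm α]
  · intro α β
    rw [add_assoc α, CharTwo.add_self_eq_zero, add_zero, add_right_comm, add_comm (G (α + β)),
      add_right_comm]
  · intro α β h
    rw [mul_eq_zero, mul_eq_zero, CharTwo.add_eq_zero] at h
    rcases h with (rfl | rfl) | rfl <;> simp [hG0, CharTwo.add_self_eq_zero]

end Reduction

section Laurent

open Polynomial

variable {K : Type*} [Field K] [Algebra (ZMod 2) K]

/-- Up to the trace, `h` is a Laurent polynomial `Q(t) / t ^ (8 τ)` of degree at most `6 τ + 1`
without terms of degree `7` or of even degree at least `8`. -/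
def HasOddTail (τ : ℕ) (h : K → K) : Prop :=
  ∃ Q : K[X], Q.natDegree ≤ 14 * τ + 1 ∧ Q.coeff (8 * τ + 7) = 0 ∧
    (∀ n, 8 * τ + 8 ≤ n → Even n → Q.coeff n = 0) ∧
    ∀ t ≠ 0, trSign (Q.eval t / t ^ (8 * τ)) = trSign (h t)

theorem HasOddTail.zero (τ : ℕ) : HasOddTail τ (fun _ : K => 0) := ⟨0, by simp⟩

theorem HasOddTail.add {τ : ℕ} {h₁ h₂ : K → K} (H₁ : HasOddTail τ h₁) (H₂ : HasOddTail τ h₂) :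
    HasOddTail τ (fun t => h₁ t + h₂ t) := by
  obtain ⟨Q₁, d₁, c₁, e₁, t₁⟩ := H₁
  obtain ⟨Q₂, d₂, c₂, e₂, t₂⟩ := H₂
  refine ⟨Q₁ + Q₂, natDegree_add_le_of_degree_le d₁ d₂, by simp [c₁, c₂],
    fun n hn hn' => by simp [e₁ n hn hn', e₂ n hn hn'], fun t ht => ?_⟩
  rw [eval_add, add_div, trSign_add, trSign_add, t₁ t ht, t₂ t ht]

theorem HasOddTail.sum {τ : ℕ} {ι : Type*} (s : Finset ι) {h : ι → K → K}
    (H : ∀ i ∈ s, HasOddTail τ (h i)) : HasOddTail τ (fun t => ∑ i ∈ s, h i t) := by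
  classical
  induction s using Finset.induction_on with
  | empty => simpa using HasOddTail.zero τ
  | insert i s hi ih =>
    simp only [sum_insert hi]
    exact (H i (mem_insert_self i s)).add (ih fun j hj => H j (mem_insert_of_mem hj))

theorem hasOddTail_of_monomial {τ N : ℕ} (γ : K) (hN : N ≤ 14 * τ + 1) (h7 : N ≠ 8 * τ + 7)
    (h8 : N < 8 * τ + 8 ∨ Odd N) {h : K → K}
    (hh : ∀ t ≠ 0, trSign (γ * t ^ N / t ^ (8 * τ)) = trSign (h t)) : HasOddTail τ h := by
  refine ⟨monomial N γ, (natDegree_monomial_le γ).trans hN, coeff_monomial_of_ne _ h7.symm, ?_, ?_⟩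
  · intro n hn hn'
    refine coeff_monomial_of_ne _ ?_
    rintro rfl
    rcases h8 with h8 | h8
    · omega
    · exact Nat.not_even_iff_odd.2 h8 hn'
  · intro t ht
    rw [eval_monomial, hh t ht]

theorem two_pow_mod_seven (i : ℕ) : 2 ^ i % 7 = 1 ∨ 2 ^ i % 7 = 2 ∨ 2 ^ i % 7 = 4 := by
  induction i with
  | zero => simp
  | succ i ih => rw [pow_succ]; omega

variable [Fintype K] [CharP K 2]

theorem hasOddTail_mul_pow_mul_inv_pow {τ i j : ℕ} (hi : 2 ^ i ≤ 2 * τ) (hj : j < i) {c : K}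
    (hc0 : c ≠ 0) (β : K) :
    HasOddTail τ (fun t => β * (c * t ^ 3) ^ (2 ^ i + 1) * (c ^ 3 * t ^ 7)⁻¹ ^ 2 ^ j) := by
  have hji : 2 * 2 ^ j ≤ 2 ^ i := by
    rw [← pow_succ']
    exact Nat.pow_le_pow_right two_pos hj
  have hi7 := two_pow_mod_seven i
  by_cases hcase : j = 0 ∧ 2 ≤ i
  · obtain ⟨rfl, hi2⟩ := hcase
    obtain ⟨l, rfl⟩ := Nat.exists_eq_add_of_le' hi2
    obtain ⟨γ, hγ⟩ := (bijective_iterateFrobenius K 2 2).surjective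
      (β * c ^ (2 ^ (l + 2) + 1) * (c ^ 3)⁻¹)
    rw [iterateFrobenius_def] at hγ
    have hl1 : 1 ≤ 2 ^ l := Nat.one_le_two_pow
    have hl : 2 ^ (l + 2) = 4 * 2 ^ l := by ring
    refine hasOddTail_of_monomial (N := 8 * τ + 3 * 2 ^ l - 1) γ (by omega) (by omega) ?_
      fun t ht => ?_
    · rcases Nat.eq_zero_or_pos l with rfl | hl0
      · left; omega
      · right
        obtain ⟨k, rfl⟩ := Nat.exists_eq_add_of_le' hl0
        exact ⟨4 * τ + 3 * 2 ^ k - 1, by rw [pow_succ]; omega⟩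
    · rw [← trSign_pow_two_pow _ 2]
      congr 1
      have e : t ^ (8 * τ + 3 * 2 ^ l - 1) * t = t ^ (8 * τ) * t ^ (3 * 2 ^ l) := by
        rw [← pow_succ, ← pow_add]
        congr 1
        omega
      have e' : γ * t ^ (8 * τ + 3 * 2 ^ l - 1) / t ^ (8 * τ) = γ * t ^ (3 * 2 ^ l) / t := by
        rw [div_eq_div_iff (pow_ne_zero _ ht) ht, mul_assoc, e]
        ring
      rw [e', div_pow, mul_pow, hγ, hl, pow_zero, pow_one]
      field_simp
      ring
  · have hN : 7 * 2 ^ j ≤ 8 * τ + 3 * (2 ^ i + 1) := by omega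
    refine hasOddTail_of_monomial (N := 8 * τ + 3 * (2 ^ i + 1) - 7 * 2 ^ j)
      (β * c ^ (2 ^ i + 1) * (c ^ 3)⁻¹ ^ 2 ^ j) ?_ (by omega) ?_ fun t ht => ?_
    · have := Nat.one_le_two_pow (n := j)
      omega
    · rcases Nat.eq_zero_or_pos j with rfl | hj0
      · left
        have : i = 1 := by omega
        subst this
        omega
      · right
        obtain ⟨k, rfl⟩ := Nat.exists_eq_add_of_le' hj0
        obtain ⟨l, rfl⟩ := Nat.exists_eq_add_of_le' (Nat.one_le_of_lt hj)
        refine ⟨4 * τ + 3 * 2 ^ l + 1 - 7 * 2 ^ k, ?_⟩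
        simp only [pow_succ] at *
        omega
    · congr 1
      have e : t ^ (8 * τ + 3 * (2 ^ i + 1) - 7 * 2 ^ j) * t ^ (7 * 2 ^ j) =
          t ^ (8 * τ) * t ^ (3 * (2 ^ i + 1)) := by
        rw [← pow_add, ← pow_add, Nat.sub_add_cancel hN]
      rw [div_eq_iff (pow_ne_zero _ ht)]
      apply mul_right_cancel₀ (pow_ne_zero (7 * 2 ^ j) ht)
      rw [mul_assoc, e, mul_pow c, ← pow_mul t, mul_inv, mul_pow _ (t ^ 7)⁻¹, inv_pow (t ^ 7),
        ← pow_mul t 7]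
      field_simp

theorem hasOddTail_quadraticPart {τ s : ℕ} (hs : ∀ i ∈ Icc 1 s, 2 ^ i ≤ 2 * τ) {c : K}
    (hc0 : c ≠ 0) (b : ℕ → K) : HasOddTail τ (quadraticPart b s c) := by
  change HasOddTail τ fun t => quadraticPart b s c t
  simp only [quadraticPart, mul_sum]
  exact .sum _ fun i hi => .sum _ fun j hj =>
    hasOddTail_mul_pow_mul_inv_pow (hs i hi) (mem_range.1 hj) hc0 (b i)

theorem HasOddTail.abs_sum_le [DecidableEq K] {μ τ : ℕ} {h : K → K} (H : HasOddTail τ h)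
    (hq : Fintype.card K = 2 * (2 ^ μ) ^ 2) (h1 : trSign (1 : K) = -1) (hτ : 1 ≤ τ) {w : K}
    (hw : w ≠ 0) (w' : K) :
    |∑ t ∈ univ.erase (0 : K), trSign (w * t ^ 7 + w' * (t ^ 7)⁻¹ + h t)| ≤ 28 * τ * 2 ^ μ := by
  obtain ⟨Q, hd, hc, he, ht⟩ := H
  set Φ : K[X] := monomial (8 * τ + 7) w + monomial (8 * τ - 7) w' + Q with hΦ
  have hcoeff : Φ.coeff (8 * τ + 7) = w := by
    rw [hΦ, coeff_add, coeff_add, coeff_monomial_same, coeff_monomial_of_ne _ (by omega), hc]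
    simp
  have hle : 8 * τ + 7 ≤ Φ.natDegree := le_natDegree_of_ne_zero (hcoeff ▸ hw)
  have hge : Φ.natDegree ≤ 14 * τ + 1 := by
    refine natDegree_add_le_of_degree_le (natDegree_add_le_of_degree_le ?_ ?_) hd
    · exact (natDegree_monomial_le _).trans (by omega)
    · exact (natDegree_monomial_le _).trans (by omega)
  have heven : ∀ n, 8 * τ + 8 ≤ n → Even n → Φ.coeff n = 0 := by
    intro n hn hn'
    rw [hΦ, coeff_add, coeff_add, coeff_monomial_of_ne _ (by omega),
      coeff_monomial_of_ne _ (by omega), he n hn hn']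
    simp
  have hodd : Odd Φ.natDegree := by
    by_contra hev
    rw [Nat.not_odd_iff_even] at hev
    have h8 : 8 * τ + 8 ≤ Φ.natDegree := by
      obtain ⟨k, hk⟩ := hev
      omega
    have : Φ = 0 := leadingCoeff_eq_zero.1 (heven _ h8 hev)
    rw [this, natDegree_zero] at hle
    omega
  obtain ⟨g, hg⟩ := hodd
  have := abs_sum_trSign_le_of_le hq h1 hg (e := 4 * τ) (by omega) (by omega) hτ (by omega)
  refine (congrArg _ (sum_congr rfl fun t ht' => ?_)).trans_le this
  have ht0 := (mem_erase.1 ht').1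
  have e7 : w' * t ^ (8 * τ - 7) / t ^ (8 * τ) = w' * (t ^ 7)⁻¹ := by
    rw [← div_eq_mul_inv, div_eq_div_iff (pow_ne_zero _ ht0) (pow_ne_zero _ ht0), mul_assoc,
      ← pow_add]
    congr 2
    omega
  rw [show 2 * (4 * τ) = 8 * τ by ring, hΦ, eval_add, eval_add, eval_monomial, eval_monomial,
    add_div, add_div, trSign_add _ (h t), ← ht t ht0, ← trSign_add, e7, pow_add, mul_left_comm,
    mul_div_cancel_left₀ _ (pow_ne_zero _ ht0)]

end Laurent

theorem stmt13 (m s : ℕ) (hm : Odd m) (hm0 : 0 < m) [Fintype (GaloisField 2 m)]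
    (a7 : GaloisField 2 m) (ha7 : a7 ≠ 0) (b : ℕ → GaloisField 2 m)
    (G : GaloisField 2 m → GaloisField 2 m)
    (hG : ∀ x, G x = a7 * x ^ 7 + ∑ i ∈ Finset.Icc 1 s, b i * x ^ (2 ^ i + 1))
    (f : GaloisField 2 m → ZMod 2)
    (hf : ∀ x, f x = Algebra.trace (ZMod 2) (GaloisField 2 m) (G x)) :
    |((1 / 2 ^ m : ℝ) * ∑ v : GaloisField 2 m, (walshF m f v : ℝ) ^ 4) -
        3 * ((2 : ℝ) ^ m) ^ 2| ≤
      185 * 2 ^ (s - 1) * ((2 : ℝ) ^ m) ^ ((3 : ℝ) / 2) := by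
  classical
  obtain ⟨c, hc⟩ := (bijective_frobenius (GaloisField 2 m) 2).surjective a7
  rw [frobenius_def] at hc
  have hc0 : c ≠ 0 := by rintro rfl; exact ha7 (by simpa using hc.symm)
  have h1 : trSign (1 : GaloisField 2 m) = -1 :=
    trSign_one (by rwa [GaloisField.finrank 2 hm0.ne'])
  have hcard : Fintype.card (GaloisField 2 m) = 2 ^ m := by
    rw [Fintype.card_eq_nat_card, GaloisField.card 2 m hm0.ne']
  obtain ⟨μ, hμ⟩ := hm
  have hq : Fintype.card (GaloisField 2 m) = 2 * (2 ^ μ) ^ 2 := by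
    rw [hcard, hμ]; ring
  have hwalsh : ∀ v, walshF m f v = ∑ x, trSign (G x) * trSign (v * x) := fun v =>
    sum_congr rfl fun x _ => by rw [neg_one_pow_val_add, hf, trSign, trSign]
  have hs : ∀ i ∈ Icc 1 s, 2 ^ i ≤ 2 * 2 ^ (s - 1) := by
    intro i hi
    rw [mem_Icc] at hi
    rw [← pow_succ']
    exact Nat.pow_le_pow_right two_pos (by omega)
  have H := hasOddTail_quadraticPart hs hc0 b
  have hτ : 1 ≤ 2 ^ (s - 1) := Nat.one_le_two_pow
  have hS₁ := H.abs_sum_le hq h1 hτ (pow_ne_zero 3 hc0) 0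
  have hS₂ := H.abs_sum_le hq h1 hτ (pow_ne_zero 3 hc0) (c ^ 3)⁻¹
  simp only [zero_mul, add_zero, ← mul_inv] at hS₁ hS₂
  have hsum := sum_walsh_pow_four_eq hc hc0 h1 hG
  simp only [← hwalsh] at hsum
  set S₁ := ∑ t ∈ univ.erase (0 : GaloisField 2 m),
    trSign (c ^ 3 * t ^ 7 + quadraticPart b s c t)
  set S₂ := ∑ t ∈ univ.erase (0 : GaloisField 2 m),
    trSign (c ^ 3 * t ^ 7 + (c ^ 3 * t ^ 7)⁻¹ + quadraticPart b s c t)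
  have hsumR : ∑ v, (walshF m f v : ℝ) ^ 4 =
      (2 ^ m) ^ 2 * (3 * 2 ^ m - 2 - 3 * (S₁ + S₂)) := by
    rw [hcard] at hsum
    exact_mod_cast hsum
  have hS₁' : |(S₁ : ℝ)| ≤ 28 * 2 ^ (s - 1) * 2 ^ μ := by exact_mod_cast hS₁
  have hS₂' : |(S₂ : ℝ)| ≤ 28 * 2 ^ (s - 1) * 2 ^ μ := by exact_mod_cast hS₂
  have hQ : (0 : ℝ) < 2 ^ m := by positivity
  have hroot : ((2 : ℝ) ^ m) * 2 ^ μ ≤ ((2 : ℝ) ^ m) ^ ((3 : ℝ) / 2) := by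
    rw [show (3 : ℝ) / 2 = 1 + 1 / 2 by norm_num, Real.rpow_add hQ, Real.rpow_one,
      ← Real.sqrt_eq_rpow]
    gcongr
    refine Real.le_sqrt_of_sq_le ?_
    rw [← pow_mul]
    exact pow_le_pow_right₀ one_le_two (by omega)
  have hτR : (1 : ℝ) ≤ 2 ^ (s - 1) := one_le_pow₀ one_le_two
  have hμR : (1 : ℝ) ≤ 2 ^ μ := one_le_pow₀ one_le_two
  have hτμ : (1 : ℝ) ≤ 2 ^ (s - 1) * 2 ^ μ := one_le_mul_of_one_le_of_one_le hτR hμR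
  rw [hsumR, show (1 / 2 ^ m : ℝ) * ((2 ^ m) ^ 2 * (3 * 2 ^ m - 2 - 3 * (S₁ + S₂))) -
    3 * ((2 : ℝ) ^ m) ^ 2 = 2 ^ m * (-2 - 3 * (S₁ + S₂)) by field_simp; ring, abs_mul,
    abs_of_pos hQ]
  calc (2 : ℝ) ^ m * |-2 - 3 * ((S₁ : ℝ) + S₂)|
      ≤ 2 ^ m * (185 * (2 ^ (s - 1) * 2 ^ μ)) := by
        gcongr
        rw [abs_le] at *
        constructor <;> linarith
    _ = 185 * 2 ^ (s - 1) * (2 ^ m * 2 ^ μ) := by ring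
    _ ≤ _ := by gcongr
end

section
/- Let q = 2^m with m odd, m ≥ 13 + 2s, and G(x) = a_7 x^7 + ∑_{i=0}^s b_i x^(2^i+1) with a_7 ≠ 0 over F_q. Then G is not APN: there exist a ∈ F_q^*, b ∈ F_q such that G(z+a)+G(z)=b has more than 2 solutions. -/
open Finset
open scoped Classical

/-- `G` is almost perfect nonlinear. -/
def IsAPN (m : ℕ) [Fintype (GaloisField 2 m)]
    (G : GaloisField 2 m → GaloisField 2 m) : Prop :=
  ∀ a : GaloisField 2 m, a ≠ 0 → ∀ b : GaloisField 2 m,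
    (Finset.univ.filter fun z => G (z + a) + G z = b).card ≤ 2

section Trace

variable {F : Type*} [Field F]

/-- The absolute trace `x + x ^ 2 + ⋯ + x ^ (2 ^ (m - 1))` of the field with `2 ^ m` elements. -/
def absTrace (m : ℕ) (x : F) : F := ∑ j ∈ Finset.range m, x ^ 2 ^ j

lemma pow_card_two_pow [Fintype F] {m : ℕ} (hF : Fintype.card F = 2 ^ m) (x : F) :
    x ^ 2 ^ m = x := by
  rw [← hF, FiniteField.pow_card]

lemma absTrace_sq [Fintype F] {m : ℕ} (hF : Fintype.card F = 2 ^ m) (x : F) :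
    absTrace m (x ^ 2) = absTrace m x := by
  have h := Finset.sum_range_succ (fun j => x ^ 2 ^ j) m
  rw [Finset.sum_range_succ', pow_card_two_pow hF, pow_zero, pow_one] at h
  simp only [absTrace, ← pow_mul, ← pow_succ']
  exact add_right_cancel h

variable [CharP F 2]

lemma absTrace_add (m : ℕ) (x y : F) : absTrace m (x + y) = absTrace m x + absTrace m y := by
  simp only [absTrace, ← Finset.sum_add_distrib]
  exact Finset.sum_congr rfl fun j _ => add_pow_char_pow x y 2 j

lemma absTrace_pow_two [Fintype F] {m : ℕ} (hF : Fintype.card F = 2 ^ m) (x : F) :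
    absTrace m x ^ 2 = absTrace m x := by
  nth_rewrite 2 [← absTrace_sq hF]
  simp only [absTrace]
  rw [sum_pow_char 2]
  exact Finset.sum_congr rfl fun j _ => by rw [← pow_mul, ← pow_mul, mul_comm]

lemma absTrace_eq_zero_or_one [Fintype F] {m : ℕ} (hF : Fintype.card F = 2 ^ m) (x : F) :
    absTrace m x = 0 ∨ absTrace m x = 1 := by
  have h := absTrace_pow_two hF x
  rcases eq_or_ne (absTrace m x) 0 with h0 | h0
  · exact Or.inl h0
  · exact Or.inr (mul_left_cancel₀ h0 (by rw [← pow_two, h, mul_one]))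

lemma absTrace_one (k : ℕ) : absTrace (2 * k + 1) (1 : F) = 1 := by
  have h2 : (2 : F) = 0 := CharTwo.two_eq_zero
  simp [absTrace, h2]

/-- The half-trace solves `y ^ 2 + y = x` when `x` has trace zero. -/
lemma exists_sq_add_self_eq_s17 [Fintype F] {k : ℕ} (hF : Fintype.card F = 2 ^ (2 * k + 1)) {x : F}
    (hx : absTrace (2 * k + 1) x = 0) : ∃ y : F, y ^ 2 + y = x := by
  have key : ∀ n : ℕ, (∑ i ∈ Finset.range (n + 1), x ^ 2 ^ (2 * i)) ^ 2 +
      ∑ i ∈ Finset.range (n + 1), x ^ 2 ^ (2 * i) = absTrace (2 * n + 2) x := by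
    intro n
    induction n with
    | zero => simp [absTrace, Finset.sum_range_succ, add_comm]
    | succ n ih =>
      have h : absTrace (2 * (n + 1) + 2) x =
          absTrace (2 * n + 2) x + x ^ 2 ^ (2 * n + 2) + x ^ 2 ^ (2 * n + 3) := by
        rw [show 2 * (n + 1) + 2 = 2 * n + 2 + 1 + 1 by ring, absTrace, Finset.sum_range_succ,
          Finset.sum_range_succ, absTrace]
      rw [h, Finset.sum_range_succ, CharTwo.add_sq, ← ih, ← pow_mul, ← pow_succ,
        show 2 * (n + 1) = 2 * n + 2 by ring]
      ring
  refine ⟨_, (key k).trans ?_⟩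
  rw [absTrace, Finset.sum_range_succ, ← absTrace, hx, zero_add, pow_card_two_pow hF]

end Trace

section Stepanov

open Polynomial

variable {F : Type*} [Field F]

/-- The numerator of `∑ i ≤ J, (p / X ^ e) ^ (2 ^ i)` over the denominator `X ^ (e * 2 ^ J)`. -/
noncomputable def truncTrace (p : F[X]) (e J : ℕ) : F[X] :=
  ∑ i ∈ Finset.range (J + 1), p ^ 2 ^ i * X ^ (e * (2 ^ J - 2 ^ i))

lemma eval_truncTrace (p : F[X]) (e J : ℕ) {x : F} (hx : x ≠ 0) :
    (truncTrace p e J).eval x =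
      x ^ (e * 2 ^ J) * absTrace (J + 1) (p.eval x / x ^ e) := by
  rw [truncTrace, absTrace, eval_finsetSum, Finset.mul_sum]
  refine Finset.sum_congr rfl fun i hi => ?_
  have h : 2 ^ i ≤ 2 ^ J := Nat.pow_le_pow_right two_pos (by simpa [Nat.lt_succ_iff] using hi)
  obtain ⟨c, hc⟩ := Nat.exists_eq_add_of_le h
  rw [hc, Nat.add_sub_cancel_left, mul_add, pow_add, div_pow, ← pow_mul x e]
  simp only [eval_mul, eval_pow, eval_X]
  field_simp

lemma natDegree_truncTrace (p : F[X]) {e d : ℕ} (J : ℕ) (hd : 0 < d)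
    (hp : p.natDegree = e + d) : (truncTrace p e J).natDegree = (e + d) * 2 ^ J := by
  have hp0 : p ≠ 0 := by rintro rfl; simp at hp; omega
  have hdeg : p.degree = ((e + d : ℕ) : WithBot ℕ) := by rw [degree_eq_natDegree hp0, hp]
  apply natDegree_eq_of_degree_eq_some
  have htop : (p ^ 2 ^ J * X ^ (e * (2 ^ J - 2 ^ J))).degree =
      (((e + d) * 2 ^ J : ℕ) : WithBot ℕ) := by
    rw [Nat.sub_self, mul_zero, pow_zero, mul_one, degree_eq_natDegree (pow_ne_zero _ hp0),
      natDegree_pow, hp, mul_comm]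
  rw [truncTrace, Finset.sum_range_succ, degree_add_eq_right_of_degree_lt, htop]
  rw [htop]
  refine (Polynomial.degree_sum_le _ _).trans_lt
    ((Finset.sup_lt_iff (WithBot.bot_lt_coe _)).2 fun i hi => ?_)
  have h : 2 ^ i < 2 ^ J := Nat.pow_lt_pow_right one_lt_two (by simpa using hi)
  obtain ⟨c, hc⟩ := Nat.exists_eq_add_of_lt h
  rw [degree_eq_natDegree (mul_ne_zero (pow_ne_zero _ hp0) (pow_ne_zero _ X_ne_zero)),
    natDegree_mul (pow_ne_zero _ hp0) (pow_ne_zero _ X_ne_zero), natDegree_pow, natDegree_X_pow, hp,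
    hc, add_assoc, Nat.add_sub_cancel_left]
  norm_cast
  nlinarith

/-- More polynomials of degree below `N` than `N` satisfy a linear relation; over a perfect field
its coefficients can be taken to be `2 ^ k`-th powers. -/
lemma exists_pow_relation [CharP F 2] [Fintype F] {ι : Type*} [Fintype ι] (k N : ℕ) (φ : ι → F[X])
    (hφ : ∀ i, (φ i).degree < N) (hN : N < Fintype.card ι) :
    ∃ c : ι → F, c ≠ 0 ∧ ∑ i, C (c i ^ 2 ^ k) * φ i = 0 := by
  have hdep : ¬ LinearIndependent F fun i => (⟨φ i, mem_degreeLT.2 (hφ i)⟩ : degreeLT F N) := by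
    intro h
    have := h.fintype_card_le_finrank
    rw [(degreeLTEquiv F N).finrank_eq, Module.finrank_fin_fun] at this
    omega
  obtain ⟨g, hg, i, hi⟩ := Fintype.not_linearIndependent_iff.1 hdep
  have hsurj : ∀ y : F, ∃ x : F, x ^ 2 ^ k = y := fun y => by
    obtain ⟨x, hx⟩ := (bijective_iterateFrobenius F 2 k).2 y
    exact ⟨x, by rw [← iterateFrobenius_def, hx]⟩
  choose r hr using hsurj
  refine ⟨fun i => r (g i), fun h => hi ?_, ?_⟩
  · rw [← hr (g i), congrFun h i]
    simp
  · have := congrArg (Subtype.val) hg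
    simpa [hr, smul_eq_C_mul] using this

lemma sum_C_mul_ne_zero {ι : Type*} [Fintype ι] (ψ : ι → F[X]) (hψ : ∀ i, ψ i ≠ 0)
    (hinj : Function.Injective fun i => (ψ i).natDegree) (c : ι → F) (hc : c ≠ 0) :
    ∑ i, C (c i) * ψ i ≠ 0 := by
  obtain ⟨j, hj⟩ := Function.ne_iff.1 hc
  intro h0
  have hdeg := degree_sum_eq_of_disjoint (fun i => C (c i) * ψ i) Finset.univ (by
    rintro a ⟨-, ha⟩ b ⟨-, hb⟩ hab heq
    refine hab (hinj ?_)
    have ha' : c a ≠ 0 := fun h => ha (by simp [h])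
    have hb' : c b ≠ 0 := fun h => hb (by simp [h])
    simp only [Function.comp, degree_C_mul ha', degree_C_mul hb'] at heq
    exact natDegree_eq_of_degree_eq heq)
  rw [h0, degree_zero] at hdeg
  have := Finset.le_sup (f := fun i => (C (c i) * ψ i).degree) (Finset.mem_univ j)
  rw [← hdeg, le_bot_iff, degree_eq_bot] at this
  exact mul_ne_zero (C_ne_zero.2 hj) (hψ j) this

/-- The auxiliary polynomials of the Stepanov method. -/
noncomputable def stepanovPoly (p : F[X]) (e k l n : ℕ) (i : Fin l × Fin n × Bool) : F[X] :=
  X ^ (2 ^ (k + 1) * i.1 + i.2.1 : ℕ) * bif i.2.2 then truncTrace p e k else X ^ (e * 2 ^ k)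

/-- The reductions of the `2 ^ k`-th powers of the auxiliary polynomials at rational points. -/
noncomputable def stepanovReduction (p : F[X]) (e k l n : ℕ) (i : Fin l × Fin n × Bool) : F[X] :=
  X ^ (i.1 + 2 ^ k * i.2.1 : ℕ) *
    bif i.2.2 then truncTrace p e (k - 1) else X ^ (e * 2 ^ (k - 1))

lemma truncTrace_ne_zero {p : F[X]} {e d : ℕ} (J : ℕ) (hd : 0 < d) (hp : p.natDegree = e + d) :
    truncTrace p e J ≠ 0 := by
  intro h
  have := natDegree_truncTrace p J hd hp
  rw [h, natDegree_zero] at this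
  have h2 : 0 < (e + d) * 2 ^ J := by positivity
  omega

lemma stepanovPoly_ne_zero {p : F[X]} {e d : ℕ} (k l n : ℕ) (hd : 0 < d)
    (hp : p.natDegree = e + d) (i : Fin l × Fin n × Bool) : stepanovPoly p e k l n i ≠ 0 := by
  refine mul_ne_zero (pow_ne_zero _ X_ne_zero) ?_
  cases i.2.2
  · exact pow_ne_zero _ X_ne_zero
  · exact truncTrace_ne_zero k hd hp

lemma natDegree_stepanovPoly {p : F[X]} {e d : ℕ} (k l n : ℕ) (hd : 0 < d)
    (hp : p.natDegree = e + d) (i : Fin l × Fin n × Bool) :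
    (stepanovPoly p e k l n i).natDegree =
      2 ^ (k + 1) * i.1 + i.2.1 + (e + bif i.2.2 then d else 0) * 2 ^ k := by
  obtain ⟨i, j, _ | _⟩ := i
  · simp [stepanovPoly, ← pow_add]
  · simp only [stepanovPoly, cond_true]
    rw [natDegree_mul (pow_ne_zero _ X_ne_zero) (truncTrace_ne_zero k hd hp), natDegree_X_pow,
      natDegree_truncTrace p k hd hp]

lemma injective_natDegree_stepanovPoly {p : F[X]} {e d : ℕ} (k l : ℕ) (hd : Odd d)
    (hp : p.natDegree = e + d) :
    Function.Injective fun i => (stepanovPoly p e k l (2 ^ k) i).natDegree := by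
  have aux : ∀ {y a b j j' : ℕ}, j < y → j' < y → y * a + j = y * b + j' → a = b ∧ j = j' := by
    intro y a b j j' hj hj' h
    have h1 := congrArg (· / y) h
    have h2 := congrArg (· % y) h
    have hy : 0 < y := by omega
    simp only [Nat.mul_add_div hy, Nat.div_eq_of_lt hj, Nat.div_eq_of_lt hj', Nat.mul_add_mod,
      Nat.mod_eq_of_lt hj, Nat.mod_eq_of_lt hj'] at h1 h2
    exact ⟨by omega, h2⟩
  obtain ⟨d', rfl⟩ := hd
  rintro ⟨i, j, b⟩ ⟨i', j', b'⟩ h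
  simp only [natDegree_stepanovPoly k l (2 ^ k) (Nat.succ_pos _) hp] at h
  have h' : 2 ^ k * (2 * i.1 + e + bif b then 2 * d' + 1 else 0) + j.1 =
      2 ^ k * (2 * i'.1 + e + bif b' then 2 * d' + 1 else 0) + j'.1 := by
    rw [pow_succ] at h
    linarith
  obtain ⟨h1, h2⟩ := aux j.2 j'.2 h'
  have hb : b = b' := by cases b <;> cases b' <;> simp at h1 ⊢ <;> omega
  subst hb
  have hi : i = i' := Fin.ext (by omega)
  have hj : j = j' := Fin.ext h2
  rw [hi, hj]

lemma degree_stepanovReduction_lt {p : F[X]} {e d : ℕ} (k l : ℕ) (hd : 0 < d)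
    (hp : p.natDegree = e + d) (i : Fin l × Fin (2 ^ k) × Bool) :
    (stepanovReduction p e k l (2 ^ k) i).degree <
      ((l + 2 ^ k * 2 ^ k + (e + d) * 2 ^ (k - 1) : ℕ) : WithBot ℕ) := by
  obtain ⟨i, j, b⟩ := i
  have h1 : (X ^ (i.1 + 2 ^ k * j.1 : ℕ) : F[X]).natDegree < l + 2 ^ k * 2 ^ k := by
    rw [natDegree_X_pow]
    have := Nat.mul_le_mul_left (2 ^ k) j.2.le
    have := i.2
    omega
  have h2 : (bif b then truncTrace p e (k - 1) else X ^ (e * 2 ^ (k - 1)) : F[X]).natDegree ≤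
      (e + d) * 2 ^ (k - 1) := by
    cases b
    · simp only [cond_false, natDegree_X_pow]
      gcongr
      omega
    · exact (natDegree_truncTrace p (k - 1) hd hp).le
  refine degree_le_natDegree.trans_lt ?_
  have := natDegree_mul_le (p := (X ^ (i.1 + 2 ^ k * j.1 : ℕ) : F[X]))
    (q := bif b then truncTrace p e (k - 1) else X ^ (e * 2 ^ (k - 1)))
  rw [stepanovReduction]
  exact Nat.cast_lt.2 (by dsimp only; omega)

variable [CharP F 2] [Fintype F]

lemma eval_stepanovPoly_pow {k : ℕ} (hk : 0 < k) (hF : Fintype.card F = 2 ^ (2 * k + 1))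
    (p : F[X]) (e l n : ℕ) {x : F} (hx : x ≠ 0)
    (htr : absTrace (2 * k + 1) (p.eval x / x ^ e) = 0) (i : Fin l × Fin n × Bool) :
    (stepanovPoly p e k l n i).eval x ^ 2 ^ k * x ^ (e * 2 ^ (k - 1)) =
      (stepanovReduction p e k l n i).eval x * x ^ (e * 2 ^ k * 2 ^ k) := by
  have hpow : ∀ r s : ℕ, (x ^ (2 ^ (k + 1) * r + s)) ^ 2 ^ k = x ^ (r + 2 ^ k * s) := by
    intro r s
    rw [← pow_mul, show (2 ^ (k + 1) * r + s) * 2 ^ k = 2 ^ (2 * k + 1) * r + 2 ^ k * s by ring,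
      pow_add, pow_mul, pow_card_two_pow hF, ← pow_add]
  have hsplit : absTrace (k + 1) (p.eval x / x ^ e) ^ 2 ^ k = absTrace k (p.eval x / x ^ e) := by
    have h : absTrace (2 * k + 1) (p.eval x / x ^ e) = absTrace k (p.eval x / x ^ e) +
        absTrace (k + 1) (p.eval x / x ^ e) ^ 2 ^ k := by
      simp only [absTrace]
      rw [show 2 * k + 1 = k + (k + 1) by ring, Finset.sum_range_add, sum_pow_char_pow]
      congr 1
      exact Finset.sum_congr rfl fun j _ => by rw [← pow_mul, ← pow_add, add_comm]
    rw [htr] at h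
    exact (CharTwo.add_eq_zero.1 h.symm).symm
  obtain ⟨i, j, _ | _⟩ := i
  · simp only [stepanovPoly, stepanovReduction, cond_false, eval_mul, eval_pow, eval_X, mul_pow,
      hpow]
    rw [← pow_mul]
    ring
  · simp only [stepanovPoly, stepanovReduction, cond_true, eval_mul, eval_pow, eval_X, mul_pow,
      hpow, eval_truncTrace p e _ hx, hsplit, Nat.sub_add_cancel hk]
    rw [← pow_mul]
    ring

/-- Stepanov's bound for the number of `x` at which `p x / x ^ e` has trace zero. -/
theorem card_absTrace_eq_zero_le {K : ℕ} (hF : Fintype.card F = 2 ^ (2 * (K + 4) + 1)) (p : F[X])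
    {e d : ℕ} (hd : Odd d) (hp : p.natDegree = e + d) (hK : e + d ≤ 2 ^ K) :
    (Finset.univ.filter fun x : F =>
      x ≠ 0 ∧ absTrace (2 * (K + 4) + 1) (p.eval x / x ^ e) = 0).card ≤ 336 * (2 ^ K) ^ 2 := by
  have hy : 0 < 2 ^ K := by positivity
  have hk : (2 : ℕ) ^ (K + 4) = 16 * 2 ^ K := by ring
  have hk1 : (2 : ℕ) ^ (K + 4 - 1) = 8 * 2 ^ K := by
    rw [show K + 4 - 1 = K + 3 by omega]; ring
  obtain ⟨c, hc0, hc⟩ := exists_pow_relation (K + 4) _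
    (stepanovReduction p e (K + 4) (10 * 2 ^ K) (2 ^ (K + 4)))
    (degree_stepanovReduction_lt (K + 4) (10 * 2 ^ K) hd.pos hp) (by
      simp only [Fintype.card_prod, Fintype.card_fin, Fintype.card_bool]
      rw [hk1, hk]
      nlinarith [Nat.mul_le_mul_right (8 * 2 ^ K) hK])
  set Ψ := stepanovPoly p e (K + 4) (10 * 2 ^ K) (2 ^ (K + 4)) with hΨ
  have hne : ∑ i, C (c i) * Ψ i ≠ 0 := sum_C_mul_ne_zero Ψ
    (stepanovPoly_ne_zero _ _ _ hd.pos hp) (injective_natDegree_stepanovPoly _ _ hd hp) c hc0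
  have hdeg : (∑ i, C (c i) * Ψ i).natDegree ≤ 336 * (2 ^ K) ^ 2 := by
    refine natDegree_sum_le_of_forall_le _ _ fun i _ => (natDegree_C_mul_le _ _).trans ?_
    rw [hΨ, natDegree_stepanovPoly _ _ _ hd.pos hp, pow_succ]
    have h1 : i.1.1 + 1 ≤ 10 * 2 ^ K := i.1.2
    have h2 : i.2.1.1 ≤ 16 * 2 ^ K := i.2.1.2.le.trans hk.le
    have h3 : (e + bif i.2.2 then d else 0) ≤ 2 ^ K := by cases i.2.2 <;> simp <;> omega
    simp only [hk]
    nlinarith [Nat.mul_le_mul_left (16 * 2 ^ K * 2) h1, Nat.mul_le_mul_right (16 * 2 ^ K) h3]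
  refine le_trans ?_ hdeg
  refine le_trans (Finset.card_le_card (t := (∑ i, C (c i) * Ψ i).roots.toFinset) fun x hx => ?_)
    ((Multiset.toFinset_card_le _).trans (card_roots' _))
  obtain ⟨hx0, htr⟩ := (Finset.mem_filter.1 hx).2
  rw [Multiset.mem_toFinset, mem_roots hne, IsRoot.def]
  refine pow_eq_zero_iff (n := 2 ^ (K + 4)) (by positivity) |>.1 ?_
  refine (mul_eq_zero.1 ?_).resolve_right (pow_ne_zero (e * 2 ^ (K + 4 - 1)) hx0)
  have hc' := congrArg (fun P => P.eval x * x ^ (e * 2 ^ (K + 4) * 2 ^ (K + 4))) hc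
  simp only [eval_finsetSum, eval_mul, eval_C, eval_zero, zero_mul] at hc' ⊢
  rw [sum_pow_char_pow, Finset.sum_mul, ← hc', Finset.sum_mul]
  refine Finset.sum_congr rfl fun i _ => ?_
  rw [mul_pow, mul_assoc, hΨ, eval_stepanovPoly_pow (by omega) hF p e _ _ hx0 htr]
  ring

/-- Stepanov's bound for the number of `x` at which `p x / x ^ e` has trace one. -/
theorem card_absTrace_eq_one_le {K : ℕ} (hF : Fintype.card F = 2 ^ (2 * (K + 4) + 1)) (p : F[X])
    {e d : ℕ} (hd : Odd d) (hp : p.natDegree = e + d) (hK : e + d ≤ 2 ^ K) :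
    (Finset.univ.filter fun x : F =>
      x ≠ 0 ∧ absTrace (2 * (K + 4) + 1) (p.eval x / x ^ e) = 1).card ≤ 336 * (2 ^ K) ^ 2 := by
  have hdpos := hd.pos
  have hp' : (p + X ^ e).natDegree = e + d := by
    rw [natDegree_add_eq_left_of_natDegree_lt (by rw [natDegree_X_pow, hp]; omega), hp]
  refine le_trans (Finset.card_le_card fun x hx => ?_) (card_absTrace_eq_zero_le hF _ hd hp' hK)
  obtain ⟨hx0, htr⟩ := (Finset.mem_filter.1 hx).2
  refine Finset.mem_filter.2 ⟨Finset.mem_univ _, hx0, ?_⟩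
  rw [eval_add, eval_pow, eval_X, add_div, div_self (pow_ne_zero _ hx0), absTrace_add, htr,
    absTrace_one, CharTwo.add_self_eq_zero]

/-- Three functions of total trace zero, each of trace one on less than two thirds of a set,
have a common point of trace zero in it. -/
lemma exists_absTrace_eq_zero {K : ℕ} (hF : Fintype.card F = 2 ^ (2 * (K + 4) + 1))
    (S : Finset F) (hS : Fintype.card F ≤ S.card + 2) (f₁ f₂ f₃ : F → F)
    (hsum : ∀ x ∈ S, f₃ x = f₁ x + f₂ x)
    (h₁ : (S.filter fun x => absTrace (2 * (K + 4) + 1) (f₁ x) = 1).card ≤ 336 * (2 ^ K) ^ 2)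
    (h₂ : (S.filter fun x => absTrace (2 * (K + 4) + 1) (f₂ x) = 1).card ≤ 336 * (2 ^ K) ^ 2)
    (h₃ : (S.filter fun x => absTrace (2 * (K + 4) + 1) (f₃ x) = 1).card ≤ 336 * (2 ^ K) ^ 2) :
    ∃ x ∈ S, absTrace (2 * (K + 4) + 1) (f₁ x) = 0 ∧ absTrace (2 * (K + 4) + 1) (f₂ x) = 0 := by
  by_contra! hno
  have hcount : 2 * S.card ≤ (S.filter fun x => absTrace (2 * (K + 4) + 1) (f₁ x) = 1).card +
      (S.filter fun x => absTrace (2 * (K + 4) + 1) (f₂ x) = 1).card +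
      (S.filter fun x => absTrace (2 * (K + 4) + 1) (f₃ x) = 1).card := by
    simp only [Finset.card_filter, ← Finset.sum_add_distrib]
    rw [mul_comm, ← smul_eq_mul, ← Finset.sum_const]
    refine Finset.sum_le_sum fun x hx => ?_
    have h := hno x hx
    rw [hsum x hx, absTrace_add]
    rcases absTrace_eq_zero_or_one hF (f₁ x) with h1 | h1 <;>
      rcases absTrace_eq_zero_or_one hF (f₂ x) with h2 | h2 <;> simp_all
  rw [hF, show (2 : ℕ) ^ (2 * (K + 4) + 1) = 512 * (2 ^ K) ^ 2 by ring] at hS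
  have : 0 < (2 ^ K) ^ 2 := by positivity
  omega

end Stepanov

section SecondDerivative

open Polynomial

variable {F : Type*} [Field F]

/-- The value that `z ^ 4 + (t ^ 2 + t + 1) * z ^ 2 + (t ^ 2 + t) * z` must take for the normalized
second derivative of `x ^ 7 + ∑ i ≤ s, β i * x ^ (2 ^ i + 1)` in the directions `a`, `a * t` to
vanish at `a * z`. -/
def flatTarget (s : ℕ) (β : ℕ → F) (a t : F) : F :=
  (t ^ 2 + t + 1) ^ 2 + ∑ i ∈ Finset.Icc 0 s,
    β i * (a ^ (2 ^ i + 1) / a ^ 7) * ((t ^ 2 ^ i + t) / (t ^ 2 + t))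

variable [CharP F 2]

lemma sq_add_self_ne_zero {t : F} (h0 : t ≠ 0) (h1 : t ≠ 1) : t ^ 2 + t ≠ 0 := by
  rw [pow_two, ← mul_add_one]
  exact mul_ne_zero h0 fun h => h1 (CharTwo.add_eq_zero.1 h)

lemma sum_flat_pow_seven (z t : F) :
    z ^ 7 + (z + 1) ^ 7 + (z + t) ^ 7 + (z + 1 + t) ^ 7 = (t ^ 2 + t) *
      (z ^ 4 + (t ^ 2 + t + 1) * z ^ 2 + (t ^ 2 + t) * z + (t ^ 2 + t + 1) ^ 2) := by
  have h2 : (2 : F) = 0 := CharTwo.two_eq_zero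
  grind

lemma sum_flat_pow_two_pow_add_one (i : ℕ) (z t : F) :
    z ^ (2 ^ i + 1) + (z + 1) ^ (2 ^ i + 1) + (z + t) ^ (2 ^ i + 1) + (z + 1 + t) ^ (2 ^ i + 1) =
      t ^ 2 ^ i + t := by
  simp only [pow_succ, add_pow_char_pow _ _ 2 i, one_pow]
  have h2 : (2 : F) = 0 := CharTwo.two_eq_zero
  linear_combination (2 * z ^ 2 ^ i * z + z ^ 2 ^ i + z + 1 + z ^ 2 ^ i * t + t ^ 2 ^ i * z +
    t ^ 2 ^ i * t) * h2

/-- The two trace conditions for `z ^ 4 + (t ^ 2 + t + 1) * z ^ 2 + (t ^ 2 + t) * z = w` to be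
solvable. -/
lemma exists_linearized_eq [Fintype F] {k : ℕ} (hF : Fintype.card F = 2 ^ (2 * k + 1)) {t w : F}
    (h0 : t ≠ 0) (h1 : t ≠ 1) (hw₁ : absTrace (2 * k + 1) (w / (t ^ 2 + t) ^ 2) = 0)
    (hw₂ : absTrace (2 * k + 1) (w / (t + 1) ^ 2) = 0) :
    ∃ z : F, z ^ 4 + (t ^ 2 + t + 1) * z ^ 2 + (t ^ 2 + t) * z = w := by
  have ht := sq_add_self_ne_zero h0 h1
  have ht1 : t + 1 ≠ 0 := fun h => h1 (CharTwo.add_eq_zero.1 h)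
  obtain ⟨y, hy⟩ := exists_sq_add_self_eq_s17 hF hw₁
  obtain ⟨z, hz⟩ : ∃ z : F, z ^ 2 + z = (t ^ 2 + t) * y := by
    apply exists_sq_add_self_eq_s17 hF
    rw [add_mul, absTrace_add, ← absTrace_sq hF (t * y), ← absTrace_add, ← hw₂]
    congr 1
    rw [show t ^ 2 * y + (t * y) ^ 2 = t ^ 2 * (y ^ 2 + y) by ring, hy]
    field_simp
  refine ⟨z, ?_⟩
  have hw : w = (t ^ 2 + t) ^ 2 * (y ^ 2 + y) := by rw [hy]; field_simp
  have h2 : (2 : F) = 0 := CharTwo.two_eq_zero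
  rw [hw]
  linear_combination (z ^ 2 + z + (t ^ 2 + t) * y) * hz + (t ^ 2 + t) * hz - z ^ 3 * h2

lemma exists_flat_sum_eq_zero [Fintype F] {k s : ℕ} (hF : Fintype.card F = 2 ^ (2 * k + 1))
    {a₇ : F} (ha₇ : a₇ ≠ 0) (b : ℕ → F) (G : F → F)
    (hG : ∀ x, G x = a₇ * x ^ 7 + ∑ i ∈ Finset.Icc 0 s, b i * x ^ (2 ^ i + 1))
    {a t : F} (ha : a ≠ 0) (h0 : t ≠ 0) (h1 : t ≠ 1)
    (hw₁ : absTrace (2 * k + 1) (flatTarget s (fun i => b i / a₇) a t / (t ^ 2 + t) ^ 2) = 0)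
    (hw₂ : absTrace (2 * k + 1) (flatTarget s (fun i => b i / a₇) a t / (t + 1) ^ 2) = 0) :
    ∃ x, G x + G (x + a) + G (x + a * t) + G (x + a + a * t) = 0 := by
  have ht := sq_add_self_ne_zero h0 h1
  have ht1 : t + 1 ≠ 0 := fun h => h1 (CharTwo.add_eq_zero.1 h)
  obtain ⟨z, hz⟩ := exists_linearized_eq hF h0 h1 hw₁ hw₂
  have hGa : ∀ x, G (a * x) = a₇ * a ^ 7 * x ^ 7 +
      ∑ i ∈ Finset.Icc 0 s, b i * a ^ (2 ^ i + 1) * x ^ (2 ^ i + 1) := fun x => by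
    simp only [hG, mul_pow, mul_assoc]
  refine ⟨a * z, ?_⟩
  rw [← mul_add_one a z, ← mul_add a z t, ← mul_add, hGa, hGa, hGa, hGa]
  have h2 : (2 : F) = 0 := CharTwo.two_eq_zero
  have htarget : flatTarget s (fun i => b i / a₇) a t + (t ^ 2 + t + 1) ^ 2 =
      ∑ i ∈ Finset.Icc 0 s,
        b i / a₇ * (a ^ (2 ^ i + 1) / a ^ 7) * ((t ^ 2 ^ i + t) / (t ^ 2 + t)) := by
    rw [flatTarget]
    linear_combination (t ^ 2 + t + 1) ^ 2 * h2
  have hquad : ∑ i ∈ Finset.Icc 0 s, b i * a ^ (2 ^ i + 1) * z ^ (2 ^ i + 1) +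
      ∑ i ∈ Finset.Icc 0 s, b i * a ^ (2 ^ i + 1) * (z + 1) ^ (2 ^ i + 1) +
      ∑ i ∈ Finset.Icc 0 s, b i * a ^ (2 ^ i + 1) * (z + t) ^ (2 ^ i + 1) +
      ∑ i ∈ Finset.Icc 0 s, b i * a ^ (2 ^ i + 1) * (z + 1 + t) ^ (2 ^ i + 1) =
      a₇ * a ^ 7 * (t ^ 2 + t) * (flatTarget s (fun i => b i / a₇) a t + (t ^ 2 + t + 1) ^ 2) := by
    rw [htarget, Finset.mul_sum, ← Finset.sum_add_distrib, ← Finset.sum_add_distrib,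
      ← Finset.sum_add_distrib]
    refine Finset.sum_congr rfl fun i _ => ?_
    rw [← mul_add, ← mul_add, ← mul_add, sum_flat_pow_two_pow_add_one]
    field_simp
  have h7 := sum_flat_pow_seven z t
  rw [hz] at h7
  linear_combination a₇ * a ^ 7 * h7 + hquad + a₇ * a ^ 7 * (t ^ 2 + t) *
    (flatTarget s (fun i => b i / a₇) a t + (t ^ 2 + t + 1) ^ 2) * h2

lemma exists_sq_eq [Fintype F] (y : F) : ∃ x : F, x ^ 2 = y := by
  obtain ⟨x, hx⟩ := (bijective_frobenius F 2).2 y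
  exact ⟨x, hx⟩

lemma inv_sq_relation {t : F} (h0 : t ≠ 0) (h1 : t ≠ 1) (w : F) :
    w / t ^ 2 = w / (t ^ 2 + t) ^ 2 + w / (t + 1) ^ 2 := by
  have ht1 : t + 1 ≠ 0 := fun h => h1 (CharTwo.add_eq_zero.1 h)
  have h2 : (2 : F) = 0 := CharTwo.two_eq_zero
  rw [show t ^ 2 + t = t * (t + 1) by ring]
  field_simp
  linear_combination w * t * h2

/-- The case of a nonzero coefficient of index at least three: fix `t`, vary `a`. -/
lemma exists_absTrace_flatTarget_of_ne_zero [Fintype F] {K s : ℕ}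
    (hF : Fintype.card F = 2 ^ (2 * (K + 4) + 1)) (hs : s ≤ K) (β : ℕ → F)
    (hβ : ∃ i ≤ s, 3 ≤ i ∧ β i ≠ 0) :
    ∃ a t : F, a ≠ 0 ∧ t ≠ 0 ∧ t ≠ 1 ∧
      absTrace (2 * (K + 4) + 1) (flatTarget s β a t / (t ^ 2 + t) ^ 2) = 0 ∧
      absTrace (2 * (K + 4) + 1) (flatTarget s β a t / (t + 1) ^ 2) = 0 := by
  obtain ⟨j, ⟨hjs, hj3, hβj⟩, hmax⟩ : ∃ j, (j ≤ s ∧ 3 ≤ j ∧ β j ≠ 0) ∧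
      ∀ i ≤ s, j < i → β i = 0 := by
    obtain ⟨i₀, hi₀, hi₀3, hβi₀⟩ := hβ
    have hfin : {i | i ≤ s ∧ 3 ≤ i ∧ β i ≠ 0}.Finite := (Set.finite_Iic s).subset fun i hi => hi.1
    obtain ⟨j, hj, hmax⟩ := hfin.exists_maximal ⟨i₀, hi₀, hi₀3, hβi₀⟩
    refine ⟨j, hj, fun i his hji => ?_⟩
    by_contra hne
    have hj3 : 3 ≤ j := hj.2.1
    have := hmax (y := i) ⟨his, by omega, hne⟩ hji.le
    omega
  obtain ⟨t, ht⟩ : ∃ t : F, t ^ 2 ^ j ≠ t := by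
    by_contra! hall
    have hlt : 1 < 2 ^ j := Nat.one_lt_two_pow (by omega)
    have hcard : Fintype.card F ≤ 2 ^ j := by
      rw [← FiniteField.X_pow_card_sub_X_natDegree_eq F hlt]
      refine le_trans ?_ (card_roots' _)
      refine le_trans (Finset.card_le_card fun x _ => ?_) (Multiset.toFinset_card_le _)
      rw [Multiset.mem_toFinset, mem_roots (FiniteField.X_pow_card_sub_X_ne_zero F hlt)]
      simp [hall]
    rw [hF] at hcard
    have := (Nat.pow_le_pow_iff_right (one_lt_two)).1 hcard
    omega
  have h0 : t ≠ 0 := by rintro rfl; exact ht (zero_pow (by positivity))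
  have h1 : t ≠ 1 := by rintro rfl; exact ht (one_pow _)
  have htt := sq_add_self_ne_zero h0 h1
  have ht1 : t + 1 ≠ 0 := fun h => h1 (CharTwo.add_eq_zero.1 h)
  choose r hr using exists_sq_eq (F := F)
  obtain ⟨j', rfl⟩ := Nat.exists_eq_add_of_le' hj3
  have hbound : ∀ θ : F, θ ≠ 0 → (Finset.filter
      (fun x => absTrace (2 * (K + 4) + 1) (flatTarget s β x t / θ) = 1)
      (Finset.univ.filter fun x : F => x ≠ 0)).card ≤ 336 * (2 ^ K) ^ 2 := by
    intro θ hθ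
    set c : ℕ → F := fun i => r (β i * ((t ^ 2 ^ i + t) / (t ^ 2 + t)) / θ) with hc
    set p : F[X] := C (r ((t ^ 2 + t + 1) ^ 2 / θ)) * X ^ 2 +
      ∑ i ∈ Finset.Icc 0 s, C (c i) * X ^ (2 ^ (i - 1) - 1) with hp
    have hpow : 1 ≤ 2 ^ j' := Nat.one_le_two_pow
    have hexp : 2 ^ (j' + 3 - 1) = 4 * 2 ^ j' := by
      rw [show j' + 3 - 1 = j' + 2 by omega]; ring
    have hdeg : p.natDegree = 2 + (4 * 2 ^ j' - 3) := by
      rw [show 2 + (4 * 2 ^ j' - 3) = 4 * 2 ^ j' - 1 by omega]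
      refine natDegree_eq_of_le_of_coeff_ne_zero (natDegree_add_le_of_degree_le ?_ ?_) ?_
      · exact (natDegree_C_mul_X_pow_le _ _).trans (by omega)
      · refine natDegree_sum_le_of_forall_le _ _ fun i hi => ?_
        rcases le_or_gt i (j' + 3) with hij | hij
        · refine (natDegree_C_mul_X_pow_le _ _).trans ?_
          rw [← hexp]
          gcongr
          exact one_le_two
        · have : c i = 0 := by
            rw [← sq_eq_zero_iff, hc, hr, hmax i (by simpa using hi) hij]
            simp
          simp [this]
      · rw [hp, coeff_add, coeff_C_mul_X_pow, if_neg (by omega), zero_add, finsetSum_coeff,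
          Finset.sum_eq_single (j' + 3)]
        · rw [coeff_C_mul_X_pow, if_pos (by rw [hexp])]
          refine (pow_ne_zero_iff two_ne_zero).1 ?_
          rw [hc, hr]
          refine div_ne_zero (mul_ne_zero hβj (div_ne_zero (fun h => ht ?_) htt)) hθ
          exact CharTwo.add_eq_zero.1 h
        · intro i _ hij
          rw [coeff_C_mul_X_pow, if_neg]
          intro h
          have hpos : 1 ≤ 2 ^ (i - 1) := Nat.one_le_two_pow
          have h' : 2 ^ (i - 1) = 2 ^ (j' + 3 - 1) := by omega
          have := Nat.pow_right_injective le_rfl h'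
          omega
        · intro h
          exact absurd (Finset.mem_Icc.2 ⟨Nat.zero_le _, hjs⟩) h
    refine le_trans (Finset.card_le_card fun x hx => ?_) (card_absTrace_eq_one_le hF p (e := 2)
      (d := 4 * 2 ^ j' - 3) ⟨2 * 2 ^ j' - 2, by omega⟩ hdeg ?_)
    · obtain ⟨hx0, htr⟩ := Finset.mem_filter.1 hx
      replace hx0 := (Finset.mem_filter.1 hx0).2
      refine Finset.mem_filter.2 ⟨Finset.mem_univ _, hx0, ?_⟩
      rw [← htr, ← absTrace_sq hF]
      congr 1
      rw [hp, eval_add, eval_finsetSum, div_pow, CharTwo.add_sq, CharTwo.sum_sq, flatTarget,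
        add_div, add_div]
      simp only [eval_mul, eval_C, eval_pow, eval_X, mul_pow, hc, hr]
      congr 1
      · field_simp
      · rw [Finset.sum_div, Finset.sum_div]
        refine Finset.sum_congr rfl fun i _ => ?_
        rcases i with _ | i
        · simp [CharTwo.add_self_eq_zero]
        · have hx : x ^ (2 ^ (i + 1) + 1) / x ^ 7 = (x ^ (2 ^ i - 1)) ^ 2 / (x ^ 2) ^ 2 := by
            obtain ⟨n, hn⟩ := Nat.exists_eq_add_of_le' (Nat.one_le_two_pow (n := i))
            rw [pow_succ 2 i, hn, Nat.add_sub_cancel]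
            field_simp
            ring
          rw [Nat.add_sub_cancel, hx]
          field_simp
    · calc 2 + (4 * 2 ^ j' - 3) ≤ 2 ^ (j' + 3) := by rw [pow_add]; omega
        _ ≤ 2 ^ K := Nat.pow_le_pow_right two_pos (hjs.trans hs)
  obtain ⟨a, ha, hw⟩ := exists_absTrace_eq_zero hF (Finset.univ.filter fun x : F => x ≠ 0)
    (by
      rw [Finset.filter_ne' Finset.univ (0 : F), Finset.card_erase_of_mem (Finset.mem_univ _),
        Finset.card_univ]
      omega)
    (fun a => flatTarget s β a t / (t ^ 2 + t) ^ 2) (fun a => flatTarget s β a t / (t + 1) ^ 2)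
    (fun a => flatTarget s β a t / t ^ 2) (fun a _ => inv_sq_relation h0 h1 _)
    (hbound _ (pow_ne_zero _ htt)) (hbound _ (pow_ne_zero _ ht1)) (hbound _ (pow_ne_zero _ h0))
  exact ⟨a, t, (Finset.mem_filter.1 ha).2, h0, h1, hw⟩

/-- The trace conditions when only the coefficients of index at most two contribute. -/
lemma exists_absTrace_eq_zero_of_quadratic [Fintype F] {K : ℕ}
    (hF : Fintype.card F = 2 ^ (2 * (K + 4) + 1)) (hK : 2 ≤ K) (A B : F)
    (hAB : 1 + A + B + B ^ 2 ≠ 0) (w : F → F)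
    (hw : ∀ t, w t = (t ^ 2 + t + 1) ^ 2 + A + B * (t ^ 2 + t + 1)) :
    ∃ t : F, t ≠ 0 ∧ t ≠ 1 ∧ absTrace (2 * (K + 4) + 1) (w t / (t ^ 2 + t) ^ 2) = 0 ∧
      absTrace (2 * (K + 4) + 1) (w t / (t + 1) ^ 2) = 0 := by
  have h2 : (2 : F) = 0 := CharTwo.two_eq_zero
  have hK4 : 4 ≤ 2 ^ K := by
    calc 4 = 2 ^ 2 := rfl
      _ ≤ 2 ^ K := Nat.pow_le_pow_right two_pos hK
  obtain ⟨α, rfl⟩ := exists_sq_eq A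
  obtain ⟨β, rfl⟩ := exists_sq_eq B
  set S : Finset F := Finset.univ.filter fun t => t ≠ 0 ∧ t ≠ 1 with hS
  have hmem : ∀ {t}, t ∈ S ↔ t ≠ 0 ∧ t ≠ 1 := by simp [hS]
  have hcard : Fintype.card F ≤ S.card + 2 := by
    have hsub : (Finset.univ : Finset F) ⊆ S ∪ {0, 1} := fun x _ => by
      simp only [Finset.mem_union, hmem, Finset.mem_insert, Finset.mem_singleton]
      tauto
    have := (Finset.card_le_card hsub).trans (Finset.card_union_le _ _)
    rw [Finset.card_univ] at this
    exact this.trans (Nat.add_le_add_left Finset.card_le_two _)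
  set p₁ : F[X] := X ^ 3 + X ^ 2 + X + C α * X + C (β ^ 2) * (X ^ 2 + X + 1) with hp₁
  have hp₁deg : p₁.natDegree = 2 + 1 := by rw [hp₁]; compute_degree!
  have htr₁ : ∀ t : F, t ≠ 0 → absTrace (2 * (K + 4) + 1) (w t / t ^ 2) =
      absTrace (2 * (K + 4) + 1) (p₁.eval t / t ^ 2) := by
    intro t h0
    have e1 : w t / t ^ 2 = ((t ^ 3 + t ^ 2 + t + α * t) / t ^ 2) ^ 2 +
        β ^ 2 * (t ^ 2 + t + 1) / t ^ 2 := by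
      rw [hw]
      field_simp
      linear_combination (-(t ^ 2 + t + 1) * α) * h2
    have e2 : p₁.eval t / t ^ 2 = (t ^ 3 + t ^ 2 + t + α * t) / t ^ 2 +
        β ^ 2 * (t ^ 2 + t + 1) / t ^ 2 := by
      simp [hp₁, add_div]
    simp only [e1, e2, absTrace_add, absTrace_sq hF]
  set p₃ : F[X] := C (1 + α + β + β ^ 2) * X ^ 2 + X + C (1 + α + β + β ^ 2) with hp₃
  have hρ : 1 + α + β + β ^ 2 ≠ 0 := by
    intro h
    apply hAB
    linear_combination (1 + α + β + β ^ 2) * h -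
      (α + β + β ^ 2 + α * β + α * β ^ 2 + β * β ^ 2) * h2
  have hp₃deg : p₃.natDegree = 1 + 1 := by rw [hp₃]; compute_degree!
  have htr₃ : ∀ t : F, t ≠ 0 → t ≠ 1 → absTrace (2 * (K + 4) + 1) (w t / (t ^ 2 + t) ^ 2) =
      absTrace (2 * (K + 4) + 1) (p₃.eval (1 / t + 1) / (1 / t + 1) ^ 1) := by
    intro t h0 h1
    have htt := sq_add_self_ne_zero h0 h1
    have ht1 : t + 1 ≠ 0 := fun h => h1 (CharTwo.add_eq_zero.1 h)
    have e1 : w t / (t ^ 2 + t) ^ 2 = ((1 + α + β) / (t ^ 2 + t)) ^ 2 +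
        (1 + β ^ 2 / (t ^ 2 + t)) := by
      rw [hw]
      generalize t ^ 2 + t = v at htt ⊢
      field_simp
      linear_combination (v - α - β - α * β) * h2
    have e2 : p₃.eval (1 / t + 1) / (1 / t + 1) ^ 1 = (1 + α + β) / (t ^ 2 + t) +
        (1 + β ^ 2 / (t ^ 2 + t)) := by
      have hu : 1 / t + 1 = (t + 1) / t := by field_simp; ring
      rw [hu, show t ^ 2 + t = t * (t + 1) by ring]
      simp only [hp₃, eval_add, eval_mul, eval_C, eval_pow, eval_X]
      field_simp
      linear_combination ((1 + α + β + β ^ 2) * (t ^ 2 + t)) * h2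
    simp only [e1, e2, absTrace_add, absTrace_sq hF]
  obtain ⟨t, ht, hres⟩ := exists_absTrace_eq_zero hF S hcard (fun t => w t / (t ^ 2 + t) ^ 2)
    (fun t => w t / (t + 1) ^ 2) (fun t => w t / t ^ 2)
    (fun t ht => inv_sq_relation (hmem.1 ht).1 (hmem.1 ht).2 _)
    (by
      refine le_trans (Finset.card_le_card_of_injOn (fun t => 1 / t + 1) ?_ ?_)
        (card_absTrace_eq_one_le hF p₃ (e := 1) (d := 1) odd_one hp₃deg (by omega))
      · intro t ht
        obtain ⟨htS, htr⟩ := Finset.mem_filter.1 ht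
        obtain ⟨h0, h1⟩ := hmem.1 htS
        refine Finset.mem_coe.2 (Finset.mem_filter.2 ⟨Finset.mem_univ _, ?_, ?_⟩)
        · intro h
          have := CharTwo.add_eq_zero.1 h
          exact h1 (by field_simp at this; exact this.symm)
        · rw [← htr₃ t h0 h1, htr]
      · intro t _ t' _ h
        simpa using h)
    (by
      refine le_trans (Finset.card_le_card_of_injOn (fun t => t + 1) ?_
        ((add_left_injective (1 : F)).injOn))
        (card_absTrace_eq_one_le hF p₁ (e := 2) (d := 1) odd_one hp₁deg (by omega))
      intro t ht
      obtain ⟨htS, htr⟩ := Finset.mem_filter.1 ht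
      obtain ⟨h0, h1⟩ := hmem.1 htS
      have ht1 : t + 1 ≠ 0 := fun h => h1 (CharTwo.add_eq_zero.1 h)
      refine Finset.mem_coe.2 (Finset.mem_filter.2 ⟨Finset.mem_univ _, ht1, ?_⟩)
      rw [← htr₁ _ ht1]
      have : w (t + 1) = w t := by
        rw [hw, hw, show (t + 1) ^ 2 + (t + 1) + 1 = t ^ 2 + t + 1 by
          linear_combination (t + 1) * h2]
      rwa [this])
    (by
      refine le_trans (Finset.card_le_card fun t ht => ?_)
        (card_absTrace_eq_one_le hF p₁ (e := 2) (d := 1) odd_one hp₁deg (by omega))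
      obtain ⟨htS, htr⟩ := Finset.mem_filter.1 ht
      obtain ⟨h0, h1⟩ := hmem.1 htS
      exact Finset.mem_filter.2 ⟨Finset.mem_univ _, h0, by rw [← htr₁ t h0, htr]⟩)
  exact ⟨t, (hmem.1 ht).1, (hmem.1 ht).2, hres⟩

/-- The case of vanishing coefficients of index at least three: fix `a`, vary `t`. -/
lemma exists_absTrace_flatTarget_of_eq_zero [Fintype F] {K s : ℕ}
    (hF : Fintype.card F = 2 ^ (2 * (K + 4) + 1)) (hK : 2 ≤ K) (β : ℕ → F)
    (hβ : ∀ i ≤ s, 3 ≤ i → β i = 0) :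
    ∃ a t : F, a ≠ 0 ∧ t ≠ 0 ∧ t ≠ 1 ∧
      absTrace (2 * (K + 4) + 1) (flatTarget s β a t / (t ^ 2 + t) ^ 2) = 0 ∧
      absTrace (2 * (K + 4) + 1) (flatTarget s β a t / (t + 1) ^ 2) = 0 := by
  set γ : ℕ → F := fun i => if i ≤ s then β i else 0 with hγ
  have htarget : ∀ a t : F, a ≠ 0 → t ≠ 0 → t ≠ 1 → flatTarget s β a t =
      (t ^ 2 + t + 1) ^ 2 + γ 1 / a ^ 4 + γ 2 / a ^ 2 * (t ^ 2 + t + 1) := by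
    intro a t ha h0 h1
    have htt := sq_add_self_ne_zero h0 h1
    have hsum : ∑ i ∈ Finset.Icc 0 s, β i * (a ^ (2 ^ i + 1) / a ^ 7) *
        ((t ^ 2 ^ i + t) / (t ^ 2 + t)) = ∑ i ∈ Finset.range 3, γ i * (a ^ (2 ^ i + 1) / a ^ 7) *
        ((t ^ 2 ^ i + t) / (t ^ 2 + t)) := by
      simp only [hγ, ite_mul, zero_mul]
      rw [← Finset.sum_filter, ← Finset.sum_filter_of_ne (p := fun i => i < 3)]
      · refine Finset.sum_congr (Finset.ext fun i => ?_) fun _ _ => rfl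
        simp only [Finset.mem_filter, Finset.mem_Icc, Finset.mem_range]
        omega
      · intro i hi hne
        by_contra hi3
        exact hne (by rw [hβ i (Finset.mem_Icc.1 hi).2 (by omega), zero_mul, zero_mul])
    rw [flatTarget, hsum]
    simp only [Finset.sum_range_succ, Finset.sum_range_zero, zero_add, pow_zero, pow_one,
      CharTwo.add_self_eq_zero, zero_div, mul_zero]
    rw [show t ^ 2 ^ 2 + t = (t ^ 2 + t) * (t ^ 2 + t + 1) by
      have h2 : (2 : F) = 0 := CharTwo.two_eq_zero
      linear_combination (-t ^ 3 - t ^ 2) * h2, div_self htt, mul_div_cancel_left₀ _ htt]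
    field_simp
    ring
  obtain ⟨u, hu0, hu⟩ : ∃ u : F, u ≠ 0 ∧ 1 + γ 1 * u ^ 2 + γ 2 * u + (γ 2 * u) ^ 2 ≠ 0 := by
    set P : F[X] := (C (γ 1 + γ 2 ^ 2) * X ^ 2 + C (γ 2) * X + 1) * X with hP
    have hP0 : P ≠ 0 := by
      refine mul_ne_zero (fun h => ?_) X_ne_zero
      have := congrArg (eval 0) h
      simp at this
    have hdeg : P.natDegree ≤ 3 := by rw [hP]; compute_degree
    obtain ⟨u, hu⟩ : ∃ u : F, P.eval u ≠ 0 := by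
      by_contra! hall
      refine hP0 (eq_zero_of_natDegree_lt_card_of_eval_eq_zero' P Finset.univ
        (fun x _ => hall x) (hdeg.trans_lt ?_))
      rw [Finset.card_univ, hF]
      calc 3 < 2 ^ 2 := by norm_num
        _ ≤ 2 ^ (2 * (K + 4) + 1) := Nat.pow_le_pow_right two_pos (by omega)
    rw [hP, eval_mul, eval_X] at hu
    refine ⟨u, right_ne_zero_of_mul hu, fun h => left_ne_zero_of_mul hu ?_⟩
    simp only [eval_add, eval_mul, eval_C, eval_pow, eval_X, eval_one]
    linear_combination h
  obtain ⟨v, rfl⟩ := exists_sq_eq u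
  have hv : v ≠ 0 := by rintro rfl; simp at hu0
  obtain ⟨t, h0, h1, hw⟩ := exists_absTrace_eq_zero_of_quadratic hF hK (γ 1 / v⁻¹ ^ 4)
    (γ 2 / v⁻¹ ^ 2) (by
      convert hu using 2
      · field_simp
      · field_simp) _ fun t => rfl
  refine ⟨v⁻¹, t, inv_ne_zero hv, h0, h1, ?_⟩
  rwa [htarget _ t (inv_ne_zero hv) h0 h1]

theorem exists_three_le_card_derivative_fiber [Fintype F] {m s : ℕ} (hm : Odd m)
    (hms : 13 + 2 * s ≤ m) (hF : Fintype.card F = 2 ^ m) {a₇ : F} (ha₇ : a₇ ≠ 0) (b : ℕ → F)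
    (G : F → F) (hG : ∀ x, G x = a₇ * x ^ 7 + ∑ i ∈ Finset.Icc 0 s, b i * x ^ (2 ^ i + 1)) :
    ∃ a : F, a ≠ 0 ∧ ∃ c, 3 ≤ (Finset.univ.filter fun z => G (z + a) + G z = c).card := by
  obtain ⟨K, rfl⟩ : ∃ K, m = 2 * (K + 4) + 1 := by
    obtain ⟨k, rfl⟩ := hm
    exact ⟨k - 4, by omega⟩
  obtain ⟨a, t, ha, h0, h1, hw₁, hw₂⟩ : ∃ a t : F, a ≠ 0 ∧ t ≠ 0 ∧ t ≠ 1 ∧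
      absTrace (2 * (K + 4) + 1) (flatTarget s (fun i => b i / a₇) a t / (t ^ 2 + t) ^ 2) = 0 ∧
      absTrace (2 * (K + 4) + 1) (flatTarget s (fun i => b i / a₇) a t / (t + 1) ^ 2) = 0 := by
    by_cases h : ∃ i ≤ s, 3 ≤ i ∧ b i / a₇ ≠ 0
    · exact exists_absTrace_flatTarget_of_ne_zero hF (by omega) _ h
    · push Not at h
      exact exists_absTrace_flatTarget_of_eq_zero hF (by omega) _ h
  obtain ⟨x, hx⟩ := exists_flat_sum_eq_zero hF ha₇ b G hG ha h0 h1 hw₁ hw₂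
  have hat1 : a * t ≠ a := fun h => h1 (mul_left_cancel₀ ha (h.trans (mul_one a).symm))
  have hcard : ({x, x + a, x + a * t} : Finset F).card = 3 :=
    Finset.card_eq_three.2
      ⟨_, _, _, by simpa using ha, by simp [ha, h0], fun h => hat1 (add_left_cancel h).symm, rfl⟩
  refine ⟨a, ha, G (x + a) + G x, hcard.symm.le.trans (Finset.card_le_card fun z hz => ?_)⟩
  refine Finset.mem_filter.2 ⟨Finset.mem_univ _, ?_⟩
  simp only [Finset.mem_insert, Finset.mem_singleton] at hz
  rcases hz with rfl | rfl | rfl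
  · rfl
  · rw [add_assoc, CharTwo.add_self_eq_zero, add_zero, add_comm]
  · rw [← CharTwo.add_eq_zero, ← hx, add_right_comm x (a * t) a]
    ring

end SecondDerivative

theorem stmt17 (m s : ℕ) (hm : Odd m) (hms : 13 + 2 * s ≤ m)
    [Fintype (GaloisField 2 m)]
    (a7 : GaloisField 2 m) (ha7 : a7 ≠ 0) (b : ℕ → GaloisField 2 m)
    (G : GaloisField 2 m → GaloisField 2 m)
    (hG : ∀ x, G x = a7 * x ^ 7 + ∑ i ∈ Finset.Icc 0 s, b i * x ^ (2 ^ i + 1)) :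
    ¬ IsAPN m G := by
  intro hAPN
  have hF : Fintype.card (GaloisField 2 m) = 2 ^ m := by
    rw [← Nat.card_eq_fintype_card, GaloisField.card 2 m (by omega)]
  obtain ⟨a, ha, c, hc⟩ := exists_three_le_card_derivative_fiber hm hms hF ha7 b G hG
  exact absurd (hc.trans (hAPN a ha c)) (by omega)
end
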